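/- arXiv:math/0301128 — 4 statements merged into one kernel-verified Lean document; each statement's English description precedes it below -/
import Mathlib

section
/- Let q be a prime power, k = F_q, V = k^r, G = GL_r(k), and let 𝔅 be the (finite) set of complete flags in V. Let H_r(q) be the ℂ-algebra presented by generators T_1, …, T_{r−1} and relations T_iT_j = T_jT_i for |i−j| > 1, T_iT_{i+1}T_i = T_{i+1}T_iT_{i+1}, and (T_i + 1)(T_i − q) = 0. Then the assignment T_i ↦ 1_{O_{s_i}}, where O_{s_i} = {((U_j),(U′_j)) ∈ 𝔅 × 𝔅 : U_j = U′_j for all j ≠ i, and U_i ≠ U′_i}, extends to an isomorphism of ℂ-algebras H_r(q) ≅ ℂ_G[𝔅 × 𝔅], the convolution algebra of G-invariant complex-valued functions on 𝔅 × 𝔅. (Iwahori–Matsumoto theorem, finite case, with the specialization v^{−2} = q.) -/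
open Module LinearMap Finset
open scoped Classical

/-- The (finite) set `𝔅` of complete flags in `V = k^r`. -/
def CFlag (k : Type*) [Field k] (r : ℕ) : Type _ :=
  {U : Fin (r + 1) → Submodule k (Fin r → k) //
    (∀ i j, i ≤ j → U i ≤ U j) ∧ ∀ i, finrank k (U i) = (i : ℕ)}

/-- The action of `GL(V)` on complete flags. -/
def flagAct {k : Type*} [Field k] {r : ℕ}
    (g : (Fin r → k) ≃ₗ[k] (Fin r → k)) (U : CFlag k r) : CFlag k r :=
  ⟨fun i => (U.1 i).map g.toLinearMap,
    fun i j h => Submodule.map_mono (U.2.1 i j h),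
    fun i => by rw [LinearEquiv.finrank_map_eq]; exact U.2.2 i⟩

/-- Convolution of functions on products of finite sets:
`(f ⋆ g)(x, z) = Σ_y f(x, y) g(y, z)`. -/
noncomputable def conv {α β γ : Type*} (f : α × β → ℂ) (g : β × γ → ℂ) :
    α × γ → ℂ :=
  fun p => ∑ᶠ y : β, f (p.1, y) * g (y, p.2)

/-- The defining relations of the Hecke algebra `H_r(q)` with generators
`T_1, …, T_{r-1}`: `T_iT_j = T_jT_i` for `|i-j| > 1`,
`T_iT_{i+1}T_i = T_{i+1}T_iT_{i+1}`, and `(T_i + 1)(T_i − q) = 0`. -/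
inductive HeckeRel (q : ℂ) (r : ℕ) :
    FreeAlgebra ℂ (Fin (r - 1)) → FreeAlgebra ℂ (Fin (r - 1)) → Prop
  | comm (i j : Fin (r - 1)) (h : (i : ℕ) + 1 < (j : ℕ) ∨ (j : ℕ) + 1 < (i : ℕ)) :
      HeckeRel q r (FreeAlgebra.ι ℂ i * FreeAlgebra.ι ℂ j)
        (FreeAlgebra.ι ℂ j * FreeAlgebra.ι ℂ i)
  | braid (i j : Fin (r - 1)) (h : (j : ℕ) = (i : ℕ) + 1) :
      HeckeRel q r (FreeAlgebra.ι ℂ i * FreeAlgebra.ι ℂ j * FreeAlgebra.ι ℂ i)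
        (FreeAlgebra.ι ℂ j * FreeAlgebra.ι ℂ i * FreeAlgebra.ι ℂ j)
  | quad (i : Fin (r - 1)) :
      HeckeRel q r
        ((FreeAlgebra.ι ℂ i + 1) *
          (FreeAlgebra.ι ℂ i - algebraMap ℂ (FreeAlgebra ℂ (Fin (r - 1))) q))
        0

section Subspaces

variable {k V : Type*} [Field k] [AddCommGroup V] [Module k V] [FiniteDimensional k V]

theorem Submodule.eq_inf_of_finrank_eq_succ {P P' L : Submodule k V} {d : ℕ}
    (hP : finrank k P = d + 1) (hP' : finrank k P' = d + 1) (hne : P ≠ P')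
    (hL : finrank k L = d) (h : L ≤ P) (h' : L ≤ P') : L = P ⊓ P' := by
  refine Submodule.eq_of_le_of_finrank_le (le_inf h h') ?_
  have hlt : P ⊓ P' < P := by
    refine lt_of_le_of_ne inf_le_left fun he => hne ?_
    exact Submodule.eq_of_le_of_finrank_le (inf_eq_left.mp he) (by omega)
  have := Submodule.finrank_lt_finrank_of_lt hlt
  omega

theorem Submodule.eq_sup_of_finrank_eq_succ {L L' P : Submodule k V} {d : ℕ}
    (hL : finrank k L = d) (hL' : finrank k L' = d) (hne : L ≠ L')
    (hP : finrank k P = d + 1) (h : L ≤ P) (h' : L' ≤ P) : P = L ⊔ L' := by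
  symm
  refine Submodule.eq_of_le_of_finrank_le (sup_le h h') ?_
  have hlt : L < L ⊔ L' := by
    refine lt_of_le_of_ne le_sup_left fun he => hne ?_
    exact (Submodule.eq_of_le_of_finrank_le (left_eq_sup.mp he) (by omega)).symm
  have := Submodule.finrank_lt_finrank_of_lt hlt
  omega

theorem Submodule.sup_span_singleton_eq {A B : Submodule k V} {v : V}
    (hAB : A ≤ B) (hd : finrank k B = finrank k A + 1) (hvB : v ∈ B) (hvA : v ∉ A) :
    A ⊔ k ∙ v = B := by
  refine Submodule.eq_of_le_of_finrank_le (sup_le hAB (by simpa using hvB)) ?_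
  rw [Submodule.finrank_sup_span_singleton hvA, hd]

theorem Submodule.exists_mem_notMem_of_finrank_lt {A B : Submodule k V}
    (hd : finrank k A < finrank k B) : ∃ v ∈ B, v ∉ A := by
  by_contra! h
  exact absurd (Submodule.finrank_mono (show B ≤ A from h)) (by omega)

end Subspaces

namespace CFlag

variable {k : Type*} [Field k] {r : ℕ}

/-- The `m`-th member of a complete flag, extended by the whole space for `m ≥ r`. -/
def sub (x : CFlag k r) (m : ℕ) : Submodule k (Fin r → k) :=
  x.1 ⟨min m r, by omega⟩

theorem sub_val (x : CFlag k r) (j : Fin (r + 1)) : x.sub j = x.1 j :=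
  congrArg x.1 (Fin.ext (min_eq_left (by omega)))

theorem sub_mono (x : CFlag k r) {m n : ℕ} (h : m ≤ n) : x.sub m ≤ x.sub n :=
  x.2.1 _ _ (by rw [Fin.mk_le_mk]; omega)

theorem finrank_sub (x : CFlag k r) {m : ℕ} (h : m ≤ r) : finrank k (x.sub m) = m := by
  rw [sub, x.2.2]
  simp only
  omega

theorem sub_of_le (x : CFlag k r) {m : ℕ} (h : r ≤ m) : x.sub m = ⊤ := by
  refine Submodule.eq_top_of_finrank_eq ?_
  rw [sub, x.2.2, finrank_fin_fun]
  simp only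
  omega

theorem ext_sub {x y : CFlag k r} (h : ∀ m, x.sub m = y.sub m) : x = y := by
  refine Subtype.ext (funext fun j => ?_)
  rw [← sub_val, ← sub_val, h]

theorem exists_sub_eq (W : ℕ → Submodule k (Fin r → k)) (hW : ∀ m < r, W m ≤ W (m + 1))
    (hrk : ∀ m ≤ r, finrank k (W m) = m) : ∃ x : CFlag k r, ∀ m ≤ r, x.sub m = W m := by
  have hmono : ∀ n ≤ r, ∀ m ≤ n, W m ≤ W n := by
    intro n
    induction n with
    | zero => intro _ m hm; rw [Nat.le_zero.mp hm]
    | succ n ih =>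
      intro hn m hm
      rcases Nat.le_succ_iff.mp hm with h | h
      · exact (ih (by omega) m h).trans (hW n (by omega))
      · rw [h]
  refine ⟨⟨fun j => W j, fun i j hij => hmono j (by omega) i hij, fun i => hrk i (by omega)⟩,
    fun m hm => ?_⟩
  unfold sub
  simp only [min_eq_left hm]

theorem exists_update (x : CFlag k r) {i : ℕ} (hi : i + 1 < r) {L : Submodule k (Fin r → k)}
    (h₁ : x.sub i ≤ L) (h₂ : L ≤ x.sub (i + 2)) (hL : finrank k L = i + 1) :
    ∃ y : CFlag k r, y.sub (i + 1) = L ∧ ∀ m, m ≠ i + 1 → x.sub m = y.sub m := by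
  obtain ⟨y, hy⟩ := exists_sub_eq (fun m => if m = i + 1 then L else x.sub m)
    (by
      intro m _
      by_cases h : m = i + 1
      · subst h; simpa using h₂
      · by_cases h' : m = i
        · subst h'; simpa using h₁
        · simpa [h, h'] using x.sub_mono (Nat.le_succ m))
    (by
      intro m hm
      by_cases h : m = i + 1
      · subst h; rw [if_pos rfl]; exact hL
      · rw [if_neg h]; exact x.finrank_sub hm)
  refine ⟨y, by simpa using hy (i + 1) hi.le, fun m hm => ?_⟩
  rcases le_total m r with h | h
  · simpa [hm] using (hy m h).symm
  · rw [sub_of_le _ h, sub_of_le _ h]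

/-- Two flags lie in the same panel of type `i` if they differ at most in dimension `i + 1`. -/
def Panel (i : ℕ) (x y : CFlag k r) : Prop :=
  ∀ m, m ≠ i + 1 → x.sub m = y.sub m

/-- Two flags are `i`-adjacent if they differ exactly in dimension `i + 1`. -/
def Adj (i : ℕ) (x y : CFlag k r) : Prop :=
  Panel i x y ∧ x ≠ y

theorem Panel.symm {i : ℕ} {x y : CFlag k r} (h : Panel i x y) : Panel i y x :=
  fun m hm => (h m hm).symm

theorem Panel.trans {i : ℕ} {x y z : CFlag k r} (h : Panel i x y) (h' : Panel i y z) :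
    Panel i x z :=
  fun m hm => (h m hm).trans (h' m hm)

theorem Panel.eq {i : ℕ} {x y : CFlag k r} (h : Panel i x y) (he : x.sub (i + 1) = y.sub (i + 1)) :
    x = y :=
  ext_sub fun m => if hm : m = i + 1 then hm ▸ he else h m hm

theorem Panel.adj {i : ℕ} {x y : CFlag k r} (h : Panel i x y)
    (hne : x.sub (i + 1) ≠ y.sub (i + 1)) : Adj i x y :=
  ⟨h, fun he => hne (he ▸ rfl)⟩

theorem Adj.ne {i : ℕ} {x y : CFlag k r} (h : Adj i x y) : x.sub (i + 1) ≠ y.sub (i + 1) :=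
  fun he => h.2 (h.1.eq he)

theorem Adj.symm {i : ℕ} {x y : CFlag k r} (h : Adj i x y) : Adj i y x :=
  ⟨h.1.symm, h.2.symm⟩

theorem Adj.lt {i : ℕ} {x y : CFlag k r} (h : Adj i x y) : i + 1 < r := by
  by_contra! hr
  exact h.ne (by rw [sub_of_le _ hr, sub_of_le _ hr])

theorem adj_comp_comm {i j : ℕ} (h : i + 1 < j ∨ j + 1 < i) {x z : CFlag k r}
    (hxz : Relation.Comp (Adj i) (Adj j) x z) : Relation.Comp (Adj j) (Adj i) x z := by
  obtain ⟨y, hxy, hyz⟩ := hxz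
  have e : ∀ m, m ≠ i + 1 → m ≠ j + 1 → x.sub m = z.sub m := fun m h₁ h₂ =>
    (hxy.1 m h₁).trans (hyz.1 m h₂)
  have hj := hyz.lt
  obtain ⟨y', hy', hxy'⟩ := x.exists_update hj (L := z.sub (j + 1))
    (by rw [e j (by omega) (by omega)]; exact z.sub_mono (by omega))
    (by rw [e (j + 2) (by omega) (by omega)]; exact z.sub_mono (by omega))
    (z.finrank_sub hj.le)
  refine ⟨y', Panel.adj hxy' ?_, Panel.adj (fun m hm => ?_) ?_⟩
  · rw [hy', hxy.1 _ (by omega)]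
    exact hyz.ne
  · by_cases h' : m = j + 1
    · rw [h', hy']
    · rw [← hxy' m h', e m hm h']
  · rw [← hxy' _ (by omega), ← hyz.1 _ (by omega)]
    exact hxy.ne

/-- Pairs of flags that differ only in dimensions `i + 1` and `i + 2`, where they are in general
position. -/
def Opposite (i : ℕ) (x z : CFlag k r) : Prop :=
  (∀ m, m ≠ i + 1 → m ≠ i + 2 → x.sub m = z.sub m) ∧
    ¬ x.sub (i + 1) ≤ z.sub (i + 2) ∧ ¬ z.sub (i + 1) ≤ x.sub (i + 2)

theorem opposite_iff_left {i : ℕ} (hi : i + 2 < r) {x z : CFlag k r} :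
    Opposite i x z ↔ Relation.Comp (Relation.Comp (Adj i) (Adj (i + 1))) (Adj i) x z := by
  have d : ∀ x : CFlag k r, finrank k (x.sub (i + 1)) = i + 1 := fun x => x.finrank_sub (by omega)
  have d' : ∀ x : CFlag k r, finrank k (x.sub (i + 2)) = i + 1 + 1 :=
    fun x => x.finrank_sub (by omega)
  constructor
  · rintro ⟨e, h₁, h₂⟩
    have hne : x.sub (i + 2) ≠ z.sub (i + 2) := fun he =>
      h₁ (he ▸ x.sub_mono (by omega))
    have hL : finrank k (x.sub (i + 2) ⊓ z.sub (i + 2) : Submodule k (Fin r → k)) = i + 1 := by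
      have h := Submodule.finrank_sup_add_finrank_inf_eq (x.sub (i + 2)) (z.sub (i + 2))
      have hs : x.sub (i + 2) ⊔ z.sub (i + 2) ≤ x.sub (i + 3) :=
        sup_le (x.sub_mono (by omega))
          (by rw [e (i + 3) (by omega) (by omega)]; exact z.sub_mono (by omega))
      have hs' := Submodule.finrank_mono hs
      have hlt : x.sub (i + 2) ⊓ z.sub (i + 2) < x.sub (i + 2) := by
        refine lt_of_le_of_ne inf_le_left fun he => hne ?_
        exact Submodule.eq_of_le_of_finrank_le (inf_eq_left.mp he) (by rw [d', d'])
      have hlt' := Submodule.finrank_lt_finrank_of_lt hlt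
      rw [x.finrank_sub (by omega)] at hs'
      rw [d', d'] at h
      rw [d'] at hlt'
      omega
    obtain ⟨y₁, hy₁, hxy₁⟩ := x.exists_update (i := i) (by omega)
      (le_inf (x.sub_mono (by omega))
        (by rw [e i (by omega) (by omega)]; exact z.sub_mono (by omega))) inf_le_left hL
    obtain ⟨y₂, hy₂, hy₁₂⟩ := y₁.exists_update (i := i + 1) hi (L := z.sub (i + 2))
      (by rw [hy₁]; exact inf_le_right)
      (by rw [← hxy₁ _ (by omega), e _ (by omega) (by omega)]; exact z.sub_mono (by omega))
      (d' z)
    have hy₂' : y₂.sub (i + 1) = x.sub (i + 2) ⊓ z.sub (i + 2) := by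
      rw [← hy₁₂ _ (by omega), hy₁]
    refine ⟨y₂, ⟨y₁, Panel.adj hxy₁ ?_, Panel.adj hy₁₂ ?_⟩, Panel.adj (fun m hm => ?_) ?_⟩
    · rw [hy₁]
      exact fun he => h₁ (he.trans_le inf_le_right)
    · rw [hy₂, ← hxy₁ _ (by omega)]
      exact hne
    · by_cases h : m = i + 2
      · rw [h, hy₂]
      · rw [← hy₁₂ m (by omega), ← hxy₁ m hm, e m hm h]
    · rw [hy₂']
      exact fun he => h₂ (he.symm.trans_le inf_le_left)
  · rintro ⟨y₂, ⟨y₁, h₁, h₂⟩, h₃⟩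
    have ex : x.sub (i + 2) = y₁.sub (i + 2) := h₁.1 _ (by omega)
    have ez : z.sub (i + 2) = y₂.sub (i + 2) := (h₃.1 _ (by omega)).symm
    have ey : y₁.sub (i + 1) = y₂.sub (i + 1) := h₂.1 _ (by omega)
    have hne : y₁.sub (i + 2) ≠ y₂.sub (i + 2) := h₂.ne
    have hy := Submodule.eq_inf_of_finrank_eq_succ (d' y₁) (d' y₂) hne (d y₁)
      (y₁.sub_mono (by omega)) (by rw [ey]; exact y₂.sub_mono (by omega))
    refine ⟨fun m hm hm' => ?_, fun h => h₁.ne ?_, fun h => h₃.symm.ne ?_⟩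
    · rw [h₁.1 m hm, h₂.1 m hm', h₃.1 m hm]
    · rw [hy]
      exact Submodule.eq_inf_of_finrank_eq_succ (d' y₁) (d' y₂) hne (d x)
        (by rw [← ex]; exact x.sub_mono (by omega)) (by rw [← ez]; exact h)
    · rw [← ey, hy]
      exact Submodule.eq_inf_of_finrank_eq_succ (d' y₁) (d' y₂) hne (d z)
        (by rw [← ex]; exact h) (by rw [← ez]; exact z.sub_mono (by omega))

theorem opposite_iff_right {i : ℕ} (hi : i + 2 < r) {x z : CFlag k r} :
    Opposite i x z ↔
      Relation.Comp (Relation.Comp (Adj (i + 1)) (Adj i)) (Adj (i + 1)) x z := by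
  have d : ∀ x : CFlag k r, finrank k (x.sub (i + 1)) = i + 1 := fun x => x.finrank_sub (by omega)
  have d' : ∀ x : CFlag k r, finrank k (x.sub (i + 2)) = i + 1 + 1 :=
    fun x => x.finrank_sub (by omega)
  constructor
  · rintro ⟨e, h₁, h₂⟩
    have hne : x.sub (i + 1) ≠ z.sub (i + 1) := fun he =>
      h₁ (he ▸ z.sub_mono (by omega))
    have hL : finrank k (x.sub (i + 1) ⊔ z.sub (i + 1) : Submodule k (Fin r → k)) =
        i + 1 + 1 := by
      have h := Submodule.finrank_sup_add_finrank_inf_eq (x.sub (i + 1)) (z.sub (i + 1))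
      have hs : x.sub i ≤ x.sub (i + 1) ⊓ z.sub (i + 1) :=
        le_inf (x.sub_mono (by omega))
          (by rw [e i (by omega) (by omega)]; exact z.sub_mono (by omega))
      have hs' := Submodule.finrank_mono hs
      have hlt : x.sub (i + 1) < x.sub (i + 1) ⊔ z.sub (i + 1) := by
        refine lt_of_le_of_ne le_sup_left fun he => hne ?_
        exact (Submodule.eq_of_le_of_finrank_le (left_eq_sup.mp he) (by rw [d, d])).symm
      have hlt' := Submodule.finrank_lt_finrank_of_lt hlt
      rw [x.finrank_sub (by omega)] at hs'
      rw [d, d] at h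
      rw [d] at hlt'
      omega
    obtain ⟨y₁, hy₁, hxy₁⟩ := x.exists_update (i := i + 1) hi le_sup_left
      (sup_le (x.sub_mono (by omega))
        (by rw [e (i + 1 + 2) (by omega) (by omega)]; exact z.sub_mono (by omega))) hL
    obtain ⟨y₂, hy₂, hy₁₂⟩ := y₁.exists_update (i := i) (by omega) (L := z.sub (i + 1))
      (by rw [← hxy₁ _ (by omega), e _ (by omega) (by omega)]; exact z.sub_mono (by omega))
      (by rw [hy₁]; exact le_sup_right)
      (d z)
    have hy₂' : y₂.sub (i + 1 + 1) = x.sub (i + 1) ⊔ z.sub (i + 1) := by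
      rw [← hy₁₂ _ (by omega), hy₁]
    refine ⟨y₂, ⟨y₁, Panel.adj hxy₁ ?_, Panel.adj hy₁₂ ?_⟩, Panel.adj (fun m hm => ?_) ?_⟩
    · rw [hy₁]
      exact fun he => h₂ (le_sup_right.trans he.symm.le)
    · rw [hy₂, ← hxy₁ _ (by omega)]
      exact hne
    · by_cases h : m = i + 1
      · rw [h, hy₂]
      · rw [← hy₁₂ m h, ← hxy₁ m hm, e m h hm]
    · rw [hy₂']
      exact fun he => h₁ (le_sup_left.trans he.le)
  · rintro ⟨y₂, ⟨y₁, h₁, h₂⟩, h₃⟩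
    have ex : x.sub (i + 1) = y₁.sub (i + 1) := h₁.1 _ (by omega)
    have ez : z.sub (i + 1) = y₂.sub (i + 1) := (h₃.1 _ (by omega)).symm
    have ey : y₁.sub (i + 2) = y₂.sub (i + 2) := h₂.1 _ (by omega)
    have hne : y₁.sub (i + 1) ≠ y₂.sub (i + 1) := h₂.ne
    have hy := Submodule.eq_sup_of_finrank_eq_succ (d y₁) (d y₂) hne (d' y₁)
      (y₁.sub_mono (by omega)) (by rw [ey]; exact y₂.sub_mono (by omega))
    refine ⟨fun m hm hm' => ?_, fun h => h₃.symm.ne ?_, fun h => h₁.ne ?_⟩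
    · rw [h₁.1 m hm', h₂.1 m hm, h₃.1 m hm']
    · rw [← ey, hy]
      exact Submodule.eq_sup_of_finrank_eq_succ (d y₁) (d y₂) hne (d' z)
        (by rw [← ex]; exact h) (by rw [← ez]; exact z.sub_mono (by omega))
    · rw [hy]
      exact Submodule.eq_sup_of_finrank_eq_succ (d y₁) (d y₂) hne (d' x)
        (by rw [← ex]; exact x.sub_mono (by omega)) (by rw [← ez]; exact h)

theorem card_adj [Fintype k] {i : ℕ} (hi : i + 1 < r) (x : CFlag k r) :
    Nat.card {y : CFlag k r // Adj i x y} = Fintype.card k := by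
  have d : ∀ m ≤ r, ∀ x : CFlag k r, finrank k (x.sub m) = m := fun m hm x => x.finrank_sub hm
  obtain ⟨u, hu, hu'⟩ := Submodule.exists_mem_notMem_of_finrank_lt (A := x.sub i)
    (B := x.sub (i + 1)) (by rw [d _ (by omega), d _ (by omega)]; omega)
  obtain ⟨w, hw, hw'⟩ := Submodule.exists_mem_notMem_of_finrank_lt (A := x.sub (i + 1))
    (B := x.sub (i + 2)) (by rw [d _ (by omega), d _ (by omega)]; omega)
  have hle : x.sub i ≤ x.sub (i + 1) := x.sub_mono (by omega)
  have hle' : x.sub (i + 1) ≤ x.sub (i + 2) := x.sub_mono (by omega)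
  have hu₁ : x.sub i ⊔ k ∙ u = x.sub (i + 1) := Submodule.sup_span_singleton_eq hle
    (by rw [d _ (by omega), d _ (by omega)]) hu hu'
  have hw₁ : x.sub (i + 1) ⊔ k ∙ w = x.sub (i + 2) := Submodule.sup_span_singleton_eq hle'
    (by rw [d _ (by omega), d _ (by omega)]) hw hw'
  have hwu : ∀ c : k, w + c • u ∉ x.sub (i + 1) := fun c hc =>
    hw' (by simpa using sub_mem hc ((x.sub (i + 1)).smul_mem c hu))
  have hrk : ∀ c : k, finrank k (x.sub i ⊔ k ∙ (w + c • u) : Submodule k (Fin r → k)) = i + 1 :=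
    fun c => by rw [Submodule.finrank_sup_span_singleton fun hc => hwu c (hle hc), d _ (by omega)]
  have hmem : ∀ c : k, w + c • u ∈ x.sub i ⊔ k ∙ (w + c • u) := fun c =>
    Submodule.mem_sup_right (Submodule.mem_span_singleton_self _)
  have hex : ∀ c : k, ∃ y : CFlag k r, y.sub (i + 1) = x.sub i ⊔ k ∙ (w + c • u) ∧
      Panel i x y := fun c =>
    x.exists_update hi le_sup_left (sup_le (hle.trans hle') (by
      rw [Submodule.span_singleton_le_iff_mem]
      exact add_mem hw (Submodule.smul_mem _ _ (hle' hu)))) (hrk c)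
  choose f hf hf' using hex
  have hadj : ∀ c, Adj i x (f c) := fun c => (hf' c).adj fun he =>
    hwu c (by rw [he, hf]; exact hmem c)
  rw [← Nat.card_eq_fintype_card]
  refine (Nat.card_congr (Equiv.ofBijective (fun c => ⟨f c, hadj c⟩) ⟨fun a b hab => ?_, ?_⟩)).symm
  · have hfab : f a = f b := congrArg Subtype.val hab
    by_contra hne
    have ha : w + a • u ∈ (f a).sub (i + 1) := by rw [hf]; exact hmem a
    have hb : w + b • u ∈ (f a).sub (i + 1) := by rw [hfab, hf]; exact hmem b
    have huf : u ∈ (f a).sub (i + 1) := by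
      have h := sub_mem ha hb
      rw [add_sub_add_left_eq_sub, ← sub_smul] at h
      exact (Submodule.smul_mem_iff _ (sub_ne_zero.mpr hne)).mp h
    refine (hadj a).ne (Submodule.eq_of_le_of_finrank_le ?_ ?_)
    · rw [← hu₁, sup_le_iff, Submodule.span_singleton_le_iff_mem]
      exact ⟨by rw [hf]; exact le_sup_left, huf⟩
    · rw [d _ (by omega), d _ (by omega)]
  · rintro ⟨y, hy⟩
    have hyi : x.sub i ≤ y.sub (i + 1) := by
      rw [hy.1 i (by omega)]
      exact y.sub_mono (by omega)
    obtain ⟨v, hv, hv'⟩ : ∃ v ∈ y.sub (i + 1), v ∉ x.sub (i + 1) := by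
      by_contra! h
      refine hy.ne (Submodule.eq_of_le_of_finrank_le (show y.sub (i + 1) ≤ _ from h) ?_).symm
      rw [d _ (by omega), d _ (by omega)]
    have hv₂ : v ∈ x.sub (i + 2) := by
      rw [hy.1 _ (by omega)]
      exact y.sub_mono (by omega) hv
    rw [← hw₁, ← hu₁] at hv₂
    obtain ⟨v₁, hv₁, cw, hcw, rfl⟩ := Submodule.mem_sup.mp hv₂
    obtain ⟨b, hb, cu, hcu, rfl⟩ := Submodule.mem_sup.mp hv₁
    obtain ⟨γ, rfl⟩ := Submodule.mem_span_singleton.mp hcw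
    obtain ⟨β, rfl⟩ := Submodule.mem_span_singleton.mp hcu
    have hγ : γ ≠ 0 := by
      rintro rfl
      apply hv'
      rw [zero_smul, add_zero, ← hu₁]
      exact hv₁
    have hy' : w + (γ⁻¹ * β) • u ∈ y.sub (i + 1) := by
      have h := (y.sub (i + 1)).smul_mem γ⁻¹ (sub_mem hv (hyi hb))
      have e : γ⁻¹ • (b + β • u + γ • w - b) = w + (γ⁻¹ * β) • u := by
        rw [add_assoc, add_sub_cancel_left, smul_add, smul_smul, smul_smul, inv_mul_cancel₀ hγ,
          one_smul, add_comm]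
      rwa [e] at h
    refine ⟨γ⁻¹ * β, Subtype.ext (Panel.eq ((hf' _).symm.trans hy.1) ?_)⟩
    rw [hf]
    refine Submodule.eq_of_le_of_finrank_le (sup_le hyi ?_) ?_
    · rwa [Submodule.span_singleton_le_iff_mem]
    · rw [hrk, d _ (by omega)]

instance [Finite k] : Finite (CFlag k r) :=
  inferInstanceAs (Finite (Subtype _))

noncomputable instance [Finite k] : Fintype (CFlag k r) :=
  Fintype.ofFinite _

end CFlag

section RelMatrix

variable {α : Type*}

/-- The 0-1 matrix of a relation. -/
noncomputable def relMatrix (R : α → α → Prop) : Matrix α α ℂ :=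
  Matrix.of fun x y => if R x y then 1 else 0

theorem relMatrix_apply (R : α → α → Prop) (x y : α) :
    relMatrix R x y = if R x y then 1 else 0 := rfl

theorem relMatrix_mul [Fintype α] {R R' : α → α → Prop}
    (h : ∀ x z y y', R x y → R' y z → R x y' → R' y' z → y = y') :
    relMatrix R * relMatrix R' = relMatrix (Relation.Comp R R') := by
  ext x z
  rw [Matrix.mul_apply, relMatrix_apply]
  split_ifs with hc
  · obtain ⟨y, h₁, h₂⟩ := hc
    rw [Finset.sum_eq_single y]
    · simp [relMatrix_apply, h₁, h₂]
    · intro y' _ hne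
      by_contra h0
      simp only [relMatrix_apply, mul_eq_zero, not_or, ite_eq_right_iff, not_forall] at h0
      obtain ⟨⟨h₃, -⟩, h₄, -⟩ := h0
      exact hne (h x z y' y h₃ h₄ h₁ h₂)
    · simp
  · refine Finset.sum_eq_zero fun y _ => ?_
    rw [relMatrix_apply, relMatrix_apply, ite_zero_mul_ite_zero, if_neg fun h' => hc ⟨y, h'⟩]

theorem sum_relMatrix [Fintype α] (R : α → α → Prop) (x : α) :
    ∑ y, relMatrix R x y = Nat.card {y // R x y} := by
  simp only [relMatrix_apply, Finset.sum_boole, Nat.card_eq_fintype_card, Fintype.card_subtype]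

theorem Matrix.exists_ne_zero_of_mul_apply_ne_zero [Fintype α] {A B : Matrix α α ℂ} {x z : α}
    (h : (A * B) x z ≠ 0) : ∃ y, A x y ≠ 0 ∧ B y z ≠ 0 := by
  rw [Matrix.mul_apply] at h
  obtain ⟨y, -, hy⟩ := Finset.exists_ne_zero_of_sum_ne_zero h
  exact ⟨y, left_ne_zero_of_mul hy, right_ne_zero_of_mul hy⟩

end RelMatrix

namespace CFlag

variable {k : Type*} [Field k] {r : ℕ}

/-- The adjacency matrix of type `i`. -/
noncomputable def adjMat (k : Type*) [Field k] (r i : ℕ) : Matrix (CFlag k r) (CFlag k r) ℂ :=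
  relMatrix (Adj i)

theorem adj_of_adjMat_ne_zero {i : ℕ} {x y : CFlag k r} (h : adjMat k r i x y ≠ 0) :
    Adj i x y := by
  by_contra h'
  exact h (if_neg h')

theorem adjMat_add_one (i : ℕ) : adjMat k r i + 1 = relMatrix (Panel i) := by
  ext x y
  rw [Matrix.add_apply, Matrix.one_apply, adjMat, relMatrix_apply, relMatrix_apply]
  by_cases h : x = y
  · subst h
    simp [Adj, Panel]
  · simp [Adj, h]

variable [Fintype k]

theorem adjMat_mul_of_ne {i j : ℕ} (h : i ≠ j) :
    adjMat k r i * adjMat k r j = relMatrix (Relation.Comp (Adj i) (Adj j)) := by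
  refine relMatrix_mul fun x z y y' h₁ h₂ h₃ h₄ => ext_sub fun m => ?_
  by_cases hm : m = i + 1
  · rw [h₂.1 m (by omega), h₄.1 m (by omega)]
  · rw [← h₁.1 m hm, ← h₃.1 m hm]

theorem adjMat_comm {i j : ℕ} (h : i + 1 < j ∨ j + 1 < i) :
    adjMat k r i * adjMat k r j = adjMat k r j * adjMat k r i := by
  rw [adjMat_mul_of_ne (by omega), adjMat_mul_of_ne (by omega)]
  congr 1
  ext x z
  exact ⟨adj_comp_comm h, adj_comp_comm h.symm⟩

theorem adjMat_braid {i : ℕ} (hi : i + 2 < r) :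
    adjMat k r i * adjMat k r (i + 1) * adjMat k r i =
      adjMat k r (i + 1) * adjMat k r i * adjMat k r (i + 1) := by
  have d : ∀ x : CFlag k r, finrank k (x.sub (i + 1)) = i + 1 := fun x => x.finrank_sub (by omega)
  have d' : ∀ x : CFlag k r, finrank k (x.sub (i + 2)) = i + 1 + 1 :=
    fun x => x.finrank_sub (by omega)
  rw [adjMat_mul_of_ne (by omega), adjMat_mul_of_ne (by omega), adjMat, adjMat, relMatrix_mul,
    relMatrix_mul]
  · congr 1
    ext x z
    rw [← opposite_iff_left hi, ← opposite_iff_right hi]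
  · have key : ∀ x z y : CFlag k r, Relation.Comp (Adj (i + 1)) (Adj i) x y → Adj (i + 1) y z →
        y.sub (i + 2) = x.sub (i + 1) ⊔ z.sub (i + 1) := by
      rintro x z y ⟨w, h₁, h₂⟩ h₃
      refine Submodule.eq_sup_of_finrank_eq_succ (d x) (d z) ?_ (d' y) ?_ ?_
      · rw [h₁.1 _ (by omega), ← h₃.1 _ (by omega)]
        exact h₂.ne
      · rw [h₁.1 _ (by omega), ← h₂.1 _ (by omega)]
        exact w.sub_mono (by omega)
      · rw [← h₃.1 _ (by omega)]
        exact y.sub_mono (by omega)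
    intro x z y y' h₁ h₂ h₃ h₄
    exact (h₂.1.trans h₄.1.symm).eq ((key x z y h₁ h₂).trans (key x z y' h₃ h₄).symm)
  · have key : ∀ x z y : CFlag k r, Relation.Comp (Adj i) (Adj (i + 1)) x y → Adj i y z →
        y.sub (i + 1) = x.sub (i + 2) ⊓ z.sub (i + 2) := by
      rintro x z y ⟨w, h₁, h₂⟩ h₃
      refine Submodule.eq_inf_of_finrank_eq_succ (d' x) (d' z) ?_ (d y) ?_ ?_
      · rw [h₁.1 _ (by omega), ← h₃.1 _ (by omega)]
        exact h₂.ne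
      · rw [h₁.1 _ (by omega), ← h₂.1 _ (by omega)]
        exact w.sub_mono (by omega)
      · rw [← h₃.1 _ (by omega)]
        exact y.sub_mono (by omega)
    intro x z y y' h₁ h₂ h₃ h₄
    exact (h₂.1.trans h₄.1.symm).eq ((key x z y h₁ h₂).trans (key x z y' h₃ h₄).symm)

theorem sum_adjMat {i : ℕ} (hi : i + 1 < r) (x : CFlag k r) :
    ∑ y, adjMat k r i x y = Fintype.card k := by
  rw [adjMat, sum_relMatrix, card_adj hi]

theorem adjMat_quad {i : ℕ} (hi : i + 1 < r) :
    (adjMat k r i + 1) * (adjMat k r i - algebraMap ℂ _ (Fintype.card k : ℂ)) = 0 := by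
  have hsq : relMatrix (Panel i) * relMatrix (Panel i) =
      ((Fintype.card k : ℂ) + 1) • relMatrix (Panel (k := k) (r := r) i) := by
    ext x z
    have hs : ∑ y, relMatrix (Panel i) x y = (Fintype.card k : ℂ) + 1 := by
      rw [← adjMat_add_one]
      simp [Finset.sum_add_distrib, sum_adjMat hi, Matrix.one_apply]
    rw [Matrix.mul_apply, Matrix.smul_apply, ← hs, smul_eq_mul, Finset.sum_mul]
    refine Finset.sum_congr rfl fun y _ => ?_
    simp only [relMatrix_apply]
    by_cases h : Panel i x y
    · have : Panel i y z ↔ Panel i x z := ⟨h.trans, h.symm.trans⟩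
      simp [this]
    · simp [h]
  have e : adjMat k r i - algebraMap ℂ _ (Fintype.card k : ℂ) =
      relMatrix (Panel i) - ((Fintype.card k : ℂ) + 1) • 1 := by
    rw [← adjMat_add_one, Algebra.algebraMap_eq_smul_one, add_smul, one_smul]
    abel
  rw [e, adjMat_add_one, mul_sub, hsq, mul_smul_comm, mul_one, sub_self]

end CFlag

/-- The index set of the normal forms in the Hecke algebra on `n` generators. -/
def NormalIdx : ℕ → Type
  | 0 => Unit
  | n + 1 => NormalIdx n × Fin (n + 2)

noncomputable instance NormalIdx.instFintype : ∀ n, Fintype (NormalIdx n)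
  | 0 => inferInstanceAs (Fintype Unit)
  | n + 1 =>
    letI := NormalIdx.instFintype n
    inferInstanceAs (Fintype (NormalIdx n × Fin (n + 2)))

theorem NormalIdx.card : ∀ n, Fintype.card (NormalIdx n) = (n + 1).factorial
  | 0 => rfl
  | n + 1 => by
    rw [Nat.factorial_succ, ← NormalIdx.card n, mul_comm]
    exact (Fintype.card_prod _ _).trans (by rw [Fintype.card_fin])

section NormalWord

variable {R : Type*}

/-- The descending product `T n * T (n - 1) * ⋯` with `j` factors. -/
def descProd [Monoid R] (T : ℕ → R) (n : ℕ) : ℕ → R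
  | 0 => 1
  | j + 1 => descProd T n j * T (n - j)

/-- The normal form attached to an index. -/
def normalWord [Monoid R] (T : ℕ → R) : ∀ n, NormalIdx n → R
  | 0, _ => 1
  | n + 1, w => normalWord T n w.1 * descProd T n w.2

theorem map_descProd [Monoid R] {R' F : Type*} [Monoid R'] [FunLike F R R']
    [MonoidHomClass F R R'] (φ : F) (T : ℕ → R) (n j : ℕ) :
    φ (descProd T n j) = descProd (fun i => φ (T i)) n j := by
  induction j with
  | zero => exact map_one φ
  | succ j ih => rw [descProd, map_mul, ih, descProd]

theorem map_normalWord [Monoid R] {R' F : Type*} [Monoid R'] [FunLike F R R']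
    [MonoidHomClass F R R'] (φ : F) (T : ℕ → R) (n : ℕ) (w : NormalIdx n) :
    φ (normalWord T n w) = normalWord (fun i => φ (T i)) n w := by
  induction n with
  | zero => exact map_one φ
  | succ n ih => rw [normalWord, map_mul, ih, map_descProd, normalWord]

theorem descProd_mul_comm [Monoid R] {T : ℕ → R} {N : ℕ}
    (hcomm : ∀ i j, j < N → i + 1 < j → T i * T j = T j * T i) {n i : ℕ} (hn : n < N) :
    ∀ j, i + j < n → descProd T n j * T i = T i * descProd T n j
  | 0, _ => by rw [descProd, one_mul, mul_one]
  | j + 1, h => by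
    rw [descProd, mul_assoc, ← hcomm i (n - j) (by omega) (by omega), ← mul_assoc,
      descProd_mul_comm hcomm hn j (by omega), mul_assoc]

theorem descProd_mul_shift [Monoid R] {T : ℕ → R} {N : ℕ}
    (hcomm : ∀ i j, j < N → i + 1 < j → T i * T j = T j * T i)
    (hbraid : ∀ i, i + 1 < N → T i * T (i + 1) * T i = T (i + 1) * T i * T (i + 1))
    {n i : ℕ} (hn : n < N) (hi : i + 1 ≤ n) :
    ∀ j, n < i + j → j ≤ n + 1 → descProd T n j * T (i + 1) = T i * descProd T n j
  | 0, h, _ => by omega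
  | j + 1, h, hj => by
    rcases Nat.lt_or_ge n (i + j) with h' | h'
    · rw [descProd, mul_assoc, hcomm (n - j) (i + 1) (by omega) (by omega), ← mul_assoc,
        descProd_mul_shift hcomm hbraid hn hi j h' (by omega), mul_assoc]
    · obtain ⟨j, rfl⟩ : ∃ j', j = j' + 1 := ⟨j - 1, by omega⟩
      have e : n - (j + 1) = i := by omega
      have e' : n - j = i + 1 := by omega
      rw [descProd, descProd, e, e', mul_assoc, mul_assoc, ← mul_assoc (T (i + 1)),
        ← hbraid i (by omega), mul_assoc (T i), ← mul_assoc,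
        descProd_mul_comm hcomm hn j (by omega), mul_assoc, mul_assoc]

variable [Ring R] [Algebra ℂ R]

theorem mul_descProd_mem_span {T : ℕ → R} {n j : ℕ} (hj : j ≤ n + 1) {s : R}
    (hs : s ∈ Submodule.span ℂ (Set.range (normalWord T n))) :
    s * descProd T n j ∈ Submodule.span ℂ (Set.range (normalWord T (n + 1))) := by
  induction hs using Submodule.span_induction with
  | mem x hx =>
    obtain ⟨w, rfl⟩ := hx
    exact Submodule.subset_span ⟨(w, ⟨j, by omega⟩), rfl⟩
  | zero => rw [zero_mul]; exact zero_mem _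
  | add x y _ _ hx hy => rw [add_mul]; exact add_mem hx hy
  | smul c x _ hx => rw [smul_mul_assoc]; exact Submodule.smul_mem _ _ hx

theorem mul_mem_span_normalWord {T : ℕ → R} {N : ℕ} {q : ℂ}
    (hcomm : ∀ i j, j < N → i + 1 < j → T i * T j = T j * T i)
    (hbraid : ∀ i, i + 1 < N → T i * T (i + 1) * T i = T (i + 1) * T i * T (i + 1))
    (hquad : ∀ i < N, T i * T i = (q - 1) • T i + q • 1) {n : ℕ} (hn : n ≤ N) {i : ℕ}
    (hi : i < n) {s : R} (hs : s ∈ Submodule.span ℂ (Set.range (normalWord T n))) :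
    s * T i ∈ Submodule.span ℂ (Set.range (normalWord T n)) := by
  induction n generalizing i s with
  | zero => omega
  | succ n ih =>
    induction hs using Submodule.span_induction with
    | mem x hx =>
      obtain ⟨⟨w, j, hj⟩, rfl⟩ := hx
      have hw : normalWord T n w ∈ Submodule.span ℂ (Set.range (normalWord T n)) :=
        Submodule.subset_span ⟨w, rfl⟩
      change normalWord T n w * descProd T n j * T i ∈ _
      rw [mul_assoc]
      rcases lt_trichotomy (i + j) n with h | h | h
      · rw [descProd_mul_comm hcomm (by omega) j h, ← mul_assoc]
        exact mul_descProd_mem_span (by omega) (ih (by omega) (by omega) hw)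
      · have e : descProd T n j * T i = descProd T n (j + 1) := by
          rw [descProd, show n - j = i by omega]
        rw [e]
        exact mul_descProd_mem_span (by omega) hw
      · rcases Nat.lt_or_ge (n + 1) (i + j) with h' | h'
        · obtain ⟨i, rfl⟩ : ∃ i', i = i' + 1 := ⟨i - 1, by omega⟩
          rw [descProd_mul_shift hcomm hbraid (by omega) (by omega) j (by omega) (by omega),
            ← mul_assoc]
          exact mul_descProd_mem_span (by omega) (ih (by omega) (by omega) hw)
        · obtain ⟨j, rfl⟩ : ∃ j', j = j' + 1 := ⟨j - 1, by omega⟩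
          have e : descProd T n (j + 1) * T i =
              (q - 1) • descProd T n (j + 1) + q • descProd T n j := by
            rw [descProd, show n - j = i by omega, mul_assoc, hquad i (by omega), mul_add,
              mul_smul_comm, mul_smul_comm, mul_one]
          rw [e, mul_add, mul_smul_comm, mul_smul_comm]
          exact add_mem (Submodule.smul_mem _ _ (mul_descProd_mem_span (by omega) hw))
            (Submodule.smul_mem _ _ (mul_descProd_mem_span (by omega) hw))
    | zero => rw [zero_mul]; exact zero_mem _
    | add x y _ _ hx hy => rw [add_mul]; exact add_mem hx hy
    | smul c x _ hx => rw [smul_mul_assoc]; exact Submodule.smul_mem _ _ hx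

theorem one_mem_span_normalWord (T : ℕ → R) (n : ℕ) :
    1 ∈ Submodule.span ℂ (Set.range (normalWord T n)) := by
  induction n with
  | zero => exact Submodule.subset_span ⟨(), rfl⟩
  | succ n ih => simpa [descProd] using mul_descProd_mem_span (Nat.zero_le _) ih

theorem span_normalWord_eq_top {T : ℕ → R} {N : ℕ} {q : ℂ}
    (hcomm : ∀ i j, j < N → i + 1 < j → T i * T j = T j * T i)
    (hbraid : ∀ i, i + 1 < N → T i * T (i + 1) * T i = T (i + 1) * T i * T (i + 1))
    (hquad : ∀ i < N, T i * T i = (q - 1) • T i + q • 1)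
    (hgen : Algebra.adjoin ℂ (T '' Set.Iio N) = ⊤) :
    Submodule.span ℂ (Set.range (normalWord T N)) = ⊤ := by
  have key : ∀ x ∈ Algebra.adjoin ℂ (T '' Set.Iio N),
      ∀ s ∈ Submodule.span ℂ (Set.range (normalWord T N)),
        s * x ∈ Submodule.span ℂ (Set.range (normalWord T N)) := by
    intro x hx
    induction hx using Algebra.adjoin_induction with
    | mem x hx =>
      obtain ⟨i, hi, rfl⟩ := hx
      exact fun s hs => mul_mem_span_normalWord hcomm hbraid hquad le_rfl hi hs
    | algebraMap c =>
      intro s hs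
      rw [← Algebra.commutes, ← Algebra.smul_def]
      exact Submodule.smul_mem _ _ hs
    | add x y _ _ hx hy => exact fun s hs => by rw [mul_add]; exact add_mem (hx s hs) (hy s hs)
    | mul x y _ _ hx hy => exact fun s hs => by rw [← mul_assoc]; exact hy _ (hx s hs)
  refine eq_top_iff.mpr fun x _ => ?_
  rw [← one_mul x]
  exact key x (hgen ▸ Algebra.mem_top) 1 (one_mem_span_normalWord T N)

end NormalWord

namespace CFlag

variable {k : Type*} [Field k] {r : ℕ}

/-- `y` is the projection of `z` to the flags containing the hyperplane `y.sub (n + 1)` of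
`z.sub (n + 2)`, where `c` is the largest index with `z.sub c ≤ y.sub (n + 1)`. -/
structure IsProj (n c : ℕ) (y z : CFlag k r) : Prop where
  low : ∀ m ≤ c, y.sub m = z.sub m
  mid : ∀ m, c ≤ m → m ≤ n + 1 → y.sub m = z.sub (m + 1) ⊓ y.sub (n + 1)
  high : ∀ m, n + 2 ≤ m → y.sub m = z.sub m
  notLE : ∀ m, c < m → m ≤ n + 1 → ¬ z.sub m ≤ y.sub (n + 1)

theorem IsProj.refl (n : ℕ) (y : CFlag k r) : IsProj n (n + 1) y y where
  low _ _ := rfl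
  mid m h h' := by
    obtain rfl : m = n + 1 := le_antisymm h' h
    exact (inf_eq_right.mpr (y.sub_mono (by omega))).symm
  high _ _ := rfl
  notLE m h h' := by omega

theorem IsProj.adj {n c : ℕ} (hn : n + 1 < r) (hc : c ≤ n) {y z z' : CFlag k r}
    (h : IsProj n (c + 1) y z) (ha : Adj c z z') : IsProj n c y z' := by
  have hd : ∀ x : CFlag k r, finrank k (x.sub (c + 1)) = c + 1 := fun x => x.finrank_sub (by omega)
  have hnot : ¬ z'.sub (c + 1) ≤ y.sub (n + 1) := by
    intro hle
    refine ha.ne (Submodule.eq_of_le_of_finrank_le ?_ (by rw [hd, hd])).symm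
    rw [← h.low _ le_rfl, h.mid _ le_rfl (by omega), ha.1 _ (by omega)]
    exact le_inf (z'.sub_mono (by omega)) hle
  have hlow : ∀ m ≤ c, y.sub m = z'.sub m := fun m hm => by
    rw [h.low m (by omega), ha.1 m (by omega)]
  refine ⟨hlow, fun m hm hm' => ?_, fun m hm => ?_, fun m hm hm' => ?_⟩
  · rcases eq_or_lt_of_le hm with rfl | hlt
    · refine Submodule.eq_of_le_of_finrank_le (le_inf ?_ (y.sub_mono (by omega))) ?_
      · rw [hlow c le_rfl]
        exact z'.sub_mono (by omega)
      · have hlt : z'.sub (c + 1) ⊓ y.sub (n + 1) < z'.sub (c + 1) :=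
          lt_of_le_of_ne inf_le_left fun he => hnot (inf_eq_left.mp he)
        have := Submodule.finrank_lt_finrank_of_lt hlt
        rw [hd] at this
        rw [y.finrank_sub (by omega)]
        omega
    · rw [← ha.1 _ (by omega), h.mid m (by omega) hm']
  · rw [h.high m hm, ha.1 m (by omega)]
  · by_cases hmc : m = c + 1
    · exact hmc ▸ hnot
    · rw [← ha.1 m hmc]
      exact h.notLE m (by omega) hm'

theorem IsProj.index_unique {n c c' : ℕ} (hc : c ≤ n + 1) (hc' : c' ≤ n + 1) {y y' z : CFlag k r}
    (h : IsProj n c y z) (h' : IsProj n c' y' z) (he : y.sub (n + 1) = y'.sub (n + 1)) :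
    c = c' := by
  have key : ∀ {a b : ℕ} {y y' : CFlag k r}, a < b → b ≤ n + 1 → IsProj n a y z → IsProj n b y' z →
      y.sub (n + 1) = y'.sub (n + 1) → False := by
    intro a b y y' hab hb h h' he
    apply h.notLE b hab hb
    rw [he, ← h'.low b le_rfl]
    exact y'.sub_mono hb
  rcases lt_trichotomy c c' with hlt | heq | hlt
  · exact (key hlt hc' h h' he).elim
  · exact heq
  · exact (key hlt hc h' h he.symm).elim

theorem IsProj.unique {n c : ℕ} {y y' z : CFlag k r} (h : IsProj n c y z) (h' : IsProj n c y' z)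
    (he : y.sub (n + 1) = y'.sub (n + 1)) : y = y' := by
  refine ext_sub fun m => ?_
  rcases le_total m c with hm | hm
  · rw [h.low m hm, h'.low m hm]
  · rcases Nat.lt_or_ge (n + 1) m with hm' | hm'
    · rw [h.high m hm', h'.high m hm']
    · rw [h.mid m hm hm', h'.mid m hm hm', he]

variable [Fintype k]

theorem isProj_of_descProd_ne_zero {n : ℕ} (hn : n + 1 < r) {y : CFlag k r} :
    ∀ {j : ℕ} {z : CFlag k r}, j ≤ n + 1 → descProd (adjMat k r) n j y z ≠ 0 →
      IsProj n (n + 1 - j) y z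
  | 0, z, _, h => by
    obtain rfl : y = z := by
      by_contra hne
      exact h (Matrix.one_apply_ne hne)
    exact IsProj.refl n y
  | j + 1, z, hj, h => by
    obtain ⟨x, h₁, h₂⟩ := Matrix.exists_ne_zero_of_mul_apply_ne_zero h
    have ih := isProj_of_descProd_ne_zero hn (by omega) h₁
    rw [show n + 1 - j = n - j + 1 by omega] at ih
    rw [show n + 1 - (j + 1) = n - j by omega]
    exact ih.adj hn (by omega) (adj_of_adjMat_ne_zero h₂)

theorem sub_eq_of_normalWord_ne_zero {n : ℕ} (hn : n < r) {w : NormalIdx n} {x z : CFlag k r}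
    (h : normalWord (adjMat k r) n w x z ≠ 0) : ∀ m, n + 1 ≤ m → x.sub m = z.sub m := by
  induction n generalizing z with
  | zero =>
    obtain rfl : x = z := by
      by_contra hne
      exact h (Matrix.one_apply_ne hne)
    exact fun _ _ => rfl
  | succ n ih =>
    obtain ⟨y, h₁, h₂⟩ := Matrix.exists_ne_zero_of_mul_apply_ne_zero h
    have hp := isProj_of_descProd_ne_zero hn (by omega) h₂
    intro m hm
    rw [ih (by omega) h₁ m (by omega), hp.high m hm]

theorem eq_of_normalWord_ne_zero {n : ℕ} (hn : n < r) {w w' : NormalIdx n} {x z : CFlag k r}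
    (h : normalWord (adjMat k r) n w x z ≠ 0) (h' : normalWord (adjMat k r) n w' x z ≠ 0) :
    w = w' := by
  induction n generalizing z with
  | zero => rfl
  | succ n ih =>
    obtain ⟨w, j⟩ := w
    obtain ⟨w', j'⟩ := w'
    obtain ⟨y, h₁, h₂⟩ := Matrix.exists_ne_zero_of_mul_apply_ne_zero h
    obtain ⟨y', h₁', h₂'⟩ := Matrix.exists_ne_zero_of_mul_apply_ne_zero h'
    simp only at h₁ h₁' h₂ h₂'
    have he : y.sub (n + 1) = y'.sub (n + 1) := by
      rw [← sub_eq_of_normalWord_ne_zero (by omega) h₁ _ le_rfl,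
        sub_eq_of_normalWord_ne_zero (by omega) h₁' _ le_rfl]
    have hp := isProj_of_descProd_ne_zero hn (by omega) h₂
    have hp' := isProj_of_descProd_ne_zero hn (by omega) h₂'
    have hj : j = j' := by
      have := hp.index_unique (by omega) (by omega) hp' he
      omega
    subst hj
    obtain rfl := hp.unique hp' he
    rw [ih (by omega) h₁ h₁']

theorem exists_sum_descProd_eq {n : ℕ} (hn : n + 1 < r) (j : ℕ) :
    ∃ c : ℂ, c ≠ 0 ∧ ∀ x : CFlag k r, ∑ y, descProd (adjMat k r) n j x y = c := by
  induction j with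
  | zero => exact ⟨1, one_ne_zero, fun x => by simp [descProd, Matrix.one_apply]⟩
  | succ j ih =>
    obtain ⟨c, hc, h⟩ := ih
    refine ⟨c * Fintype.card k, mul_ne_zero hc (by simp), fun x => ?_⟩
    simp only [descProd, Matrix.mul_apply]
    rw [Finset.sum_comm]
    simp only [← Finset.mul_sum, sum_adjMat (show n - j + 1 < r by omega), ← Finset.sum_mul, h]

theorem exists_sum_normalWord_eq {n : ℕ} (hn : n < r) (w : NormalIdx n) :
    ∃ c : ℂ, c ≠ 0 ∧ ∀ x : CFlag k r, ∑ y, normalWord (adjMat k r) n w x y = c := by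
  induction n with
  | zero => exact ⟨1, one_ne_zero, fun x => by simp [normalWord, Matrix.one_apply]⟩
  | succ n ih =>
    obtain ⟨c, hc, h⟩ := ih (by omega) w.1
    obtain ⟨c', hc', h'⟩ := exists_sum_descProd_eq (k := k) hn w.2
    refine ⟨c * c', mul_ne_zero hc hc', fun x => ?_⟩
    simp only [normalWord, Matrix.mul_apply]
    rw [Finset.sum_comm]
    simp only [← Finset.mul_sum, h', ← Finset.sum_mul, h]

theorem linearIndependent_normalWord [Nonempty (CFlag k r)] {n : ℕ} (hn : n < r) :
    LinearIndependent ℂ (normalWord (adjMat k r) n) := by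
  rw [Fintype.linearIndependent_iff]
  intro g hg w
  obtain ⟨c, hc, h⟩ := exists_sum_normalWord_eq (k := k) hn w
  obtain ⟨x⟩ := ‹Nonempty (CFlag k r)›
  rw [← h x] at hc
  obtain ⟨z, -, hz⟩ := Finset.exists_ne_zero_of_sum_ne_zero hc
  have hxz := congrFun (congrFun hg x) z
  rw [Matrix.sum_apply, Finset.sum_eq_single w] at hxz
  · simpa [hz] using hxz
  · intro w' _ hne
    by_contra h0
    rw [Matrix.smul_apply, smul_eq_mul] at h0
    exact hne (eq_of_normalWord_ne_zero hn (right_ne_zero_of_mul h0) hz)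
  · simp

end CFlag

namespace CFlag

variable {k : Type*} [Field k] {r : ℕ}

/-- A family of vectors is adapted to a flag if its `a`-th member lies in the flag from dimension
`a + 1` on. -/
def Adapted (v : Fin r → Fin r → k) (x : CFlag k r) : Prop :=
  ∀ a : Fin r, v a ∈ x.sub (a + 1) ∧ v a ∉ x.sub a

theorem Adapted.sub_eq_span {v : Fin r → Fin r → k} {x : CFlag k r} (h : Adapted v x) :
    ∀ m ≤ r, x.sub m = Submodule.span k (v '' {a | (a : ℕ) < m})
  | 0, hm => by
    have : x.sub 0 = ⊥ := Submodule.finrank_eq_zero.mp (x.finrank_sub hm)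
    simp [this]
  | m + 1, hm => by
    have hs : {a : Fin r | (a : ℕ) < m + 1} =
        {a : Fin r | (a : ℕ) < m} ∪ {(⟨m, hm⟩ : Fin r)} := by
      ext a
      simp [Fin.ext_iff]
      omega
    rw [hs, Set.image_union, Submodule.span_union, ← h.sub_eq_span m (by omega),
      Set.image_singleton]
    refine (Submodule.sup_span_singleton_eq (x.sub_mono (by omega)) ?_ (h ⟨m, hm⟩).1
      (h ⟨m, hm⟩).2).symm
    rw [x.finrank_sub hm, x.finrank_sub (by omega)]

theorem Adapted.linearIndependent {v : Fin r → Fin r → k} {x : CFlag k r} (h : Adapted v x) :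
    LinearIndependent k v := by
  refine linearIndependent_of_top_le_span_of_card_eq_finrank ?_ (by simp)
  rw [← x.sub_of_le le_rfl, h.sub_eq_span r le_rfl]
  exact Submodule.span_mono (Set.image_subset_range _ _)

/-- The flag spanned by the initial segments of a basis. -/
def ofBasis (b : Basis (Fin r) k (Fin r → k)) : CFlag k r :=
  ⟨fun i => Submodule.span k (b '' {a | (a : ℕ) < i}),
    fun i j hij => Submodule.span_mono (Set.image_mono fun a (ha : (a : ℕ) < i) =>
      lt_of_lt_of_le ha hij), fun i => by
    have hli : LinearIndependent k fun a : {a : Fin r // (a : ℕ) < i} => b a :=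
      b.linearIndependent.comp _ Subtype.val_injective
    have h := finrank_span_eq_card hli
    have hr : Set.range (fun a : {a : Fin r // (a : ℕ) < i} => b a) =
        b '' {a | (a : ℕ) < i} := by
      rw [Set.image_eq_range]
      rfl
    rw [hr] at h
    rw [h, Fintype.card_subtype, Fin.card_filter_val_lt]
    omega⟩

theorem flagAct_ofBasis (b : Basis (Fin r) k (Fin r → k)) (x : CFlag k r)
    (g : (Fin r → k) ≃ₗ[k] (Fin r → k)) (h : Adapted (fun a => g (b a)) x) :
    flagAct g (ofBasis b) = x := by
  refine Subtype.ext (funext fun i => ?_)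
  rw [← sub_val x, h.sub_eq_span i (by omega)]
  simp only [flagAct, ofBasis]
  rw [Submodule.map_span, Set.image_image]
  rfl

/-- The flag spanned by the initial segments of the permuted standard basis. -/
noncomputable def coord (k : Type*) [Field k] {r : ℕ} (σ : Equiv.Perm (Fin r)) : CFlag k r :=
  ofBasis ((Pi.basisFun k (Fin r)).reindex σ.symm)

instance : Nonempty (CFlag k r) := ⟨coord k 1⟩

theorem exists_adapted (x z : CFlag k r) :
    ∃ (v : Fin r → Fin r → k) (σ : Equiv.Perm (Fin r)), Adapted v x ∧ Adapted (v ∘ σ) z := by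
  have hex : ∀ a : Fin r, ∃ b : ℕ, ∃ v ∈ x.sub (a + 1), v ∈ z.sub (b + 1) ∧ v ∉ x.sub a := by
    intro a
    obtain ⟨v, hv, hv'⟩ := Submodule.exists_mem_notMem_of_finrank_lt (A := x.sub a)
      (B := x.sub (a + 1)) (by rw [x.finrank_sub (by omega), x.finrank_sub (by omega)]; omega)
    exact ⟨r, v, hv, by rw [z.sub_of_le (by omega)]; exact Submodule.mem_top, hv'⟩
  choose v hv using fun a => Nat.find_spec (hex a)
  set τ : Fin r → ℕ := fun a => Nat.find (hex a)
  have hvx : ∀ a : Fin r, v a ∈ x.sub (a + 1) := fun a => (hv a).1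
  have hvz : ∀ a : Fin r, v a ∈ z.sub (τ a + 1) := fun a => (hv a).2.1
  have hvn : ∀ a : Fin r, v a ∉ x.sub a := fun a => (hv a).2.2
  have hmin : ∀ (a : Fin r) (u), u ∈ x.sub (a + 1) → u ∉ x.sub a → u ∉ z.sub (τ a) := by
    intro a u hu hu' huz
    rcases Nat.eq_zero_or_pos (τ a) with h0 | hpos
    · have : z.sub 0 = ⊥ := Submodule.finrank_eq_zero.mp (z.finrank_sub (Nat.zero_le _))
      rw [h0, this, Submodule.mem_bot] at huz
      exact hu' (huz ▸ zero_mem _)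
    · refine Nat.find_min (hex a) (Nat.sub_lt hpos one_pos) ⟨u, hu, ?_, hu'⟩
      have e : τ a - 1 + 1 = τ a := Nat.sub_add_cancel hpos
      change u ∈ z.sub (τ a - 1 + 1)
      rwa [e]
  have hlt : ∀ a : Fin r, τ a < r := by
    intro a
    by_contra! h
    exact hmin a (v a) (hvx a) (hvn a) (by rw [z.sub_of_le h]; exact Submodule.mem_top)
  have hinj : ∀ a a' : Fin r, a < a' → τ a ≠ τ a' := by
    intro a a' haa he
    have hvz' : z.sub (τ a') ⊔ k ∙ v a = z.sub (τ a' + 1) := by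
      refine Submodule.sup_span_singleton_eq (z.sub_mono (by omega)) ?_ (he ▸ hvz a)
        (he ▸ hmin a (v a) (hvx a) (hvn a))
      have := hlt a'
      rw [z.finrank_sub (by omega), z.finrank_sub (by omega)]
    have hmem := hvz a'
    rw [← hvz'] at hmem
    obtain ⟨u, hu, t, ht, hut⟩ := Submodule.mem_sup.mp hmem
    obtain ⟨c, rfl⟩ := Submodule.mem_span_singleton.mp ht
    have hva : c • v a ∈ x.sub a' := Submodule.smul_mem _ _ (x.sub_mono (by omega) (hvx a))
    have hu' : u = v a' - c • v a := by rw [← hut, add_sub_cancel_right]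
    refine hmin a' u ?_ ?_ hu
    · rw [hu']
      exact sub_mem (hvx a') (x.sub_mono (by omega) hva)
    · intro hux
      apply hvn a'
      rw [← hut]
      exact add_mem hux hva
  have hbij : Function.Bijective fun a : Fin r => (⟨τ a, hlt a⟩ : Fin r) := by
    refine Finite.injective_iff_bijective.mp fun a a' h => ?_
    have h' : τ a = τ a' := congrArg Fin.val h
    rcases lt_trichotomy a a' with hl | he | hl
    · exact (hinj a a' hl h').elim
    · exact he
    · exact (hinj a' a hl h'.symm).elim
  refine ⟨v, (Equiv.ofBijective _ hbij).symm, fun a => ⟨hvx a, hvn a⟩, fun b => ?_⟩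
  obtain ⟨a, rfl⟩ := hbij.surjective b
  have e : (Equiv.ofBijective _ hbij).symm ⟨τ a, hlt a⟩ = a :=
    (Equiv.ofBijective _ hbij).symm_apply_apply a
  simp only [Function.comp_apply, e]
  exact ⟨hvz a, hmin a _ (hvx a) (hvn a)⟩

theorem exists_flagAct_eq (x z : CFlag k r) :
    ∃ (g : (Fin r → k) ≃ₗ[k] (Fin r → k)) (σ : Equiv.Perm (Fin r)),
      flagAct g (coord k 1) = x ∧ flagAct g (coord k σ) = z := by
  obtain ⟨v, σ, hx, hz⟩ := exists_adapted x z
  have hspan : ⊤ ≤ Submodule.span k (Set.range v) := by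
    rw [← x.sub_of_le le_rfl, hx.sub_eq_span r le_rfl]
    exact Submodule.span_mono (Set.image_subset_range _ _)
  let b : Basis (Fin r) k (Fin r → k) := Basis.mk hx.linearIndependent hspan
  let g := (Pi.basisFun k (Fin r)).equiv b (Equiv.refl _)
  have hg : ∀ a, g (Pi.basisFun k (Fin r) a) = v a := fun a => by
    rw [Basis.equiv_apply, Basis.mk_apply, Equiv.refl_apply]
  refine ⟨g, σ, flagAct_ofBasis _ _ _ ?_, flagAct_ofBasis _ _ _ ?_⟩
  · simp only [Basis.reindex_apply, hg]
    exact hx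
  · simp only [Basis.reindex_apply, hg]
    exact hz

theorem flagAct_injective (g : (Fin r → k) ≃ₗ[k] (Fin r → k)) :
    Function.Injective (flagAct g) := by
  intro x y h
  refine Subtype.ext (funext fun i => ?_)
  exact Submodule.map_injective_of_injective g.injective (congrFun (congrArg Subtype.val h) i)

theorem adj_flagAct_iff (g : (Fin r → k) ≃ₗ[k] (Fin r → k)) {i : ℕ} {x y : CFlag k r} :
    Adj i (flagAct g x) (flagAct g y) ↔ Adj i x y := by
  have hinj : ∀ m, (flagAct g x).sub m = (flagAct g y).sub m ↔ x.sub m = y.sub m := fun m =>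
    (Submodule.map_injective_of_injective g.injective).eq_iff
  simp only [Adj, Panel, hinj, (flagAct_injective g).ne_iff]

variable [Fintype k]

/-- The subalgebra of `GL(V)`-invariant matrices indexed by complete flags. -/
noncomputable def invariants (k : Type*) [Field k] [Fintype k] (r : ℕ) :
    Subalgebra ℂ (Matrix (CFlag k r) (CFlag k r) ℂ) where
  carrier := {M | ∀ g x y, M (flagAct g x) (flagAct g y) = M x y}
  mul_mem' {A B} hA hB g x z := by
    rw [Matrix.mul_apply, Matrix.mul_apply]
    rw [← (Finite.injective_iff_bijective.mp (flagAct_injective g)).sum_comp]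
    simp only [hA g, hB g]
  add_mem' {A B} hA hB g x z := by
    rw [Matrix.add_apply, Matrix.add_apply, hA, hB]
  algebraMap_mem' c g x z := by
    simp only [Matrix.algebraMap_matrix_apply, (flagAct_injective g).eq_iff]

theorem adjMat_mem_invariants (i : ℕ) : adjMat k r i ∈ invariants k r := by
  intro g x y
  simp only [adjMat, relMatrix_apply, adj_flagAct_iff]

theorem finrank_invariants_le :
    finrank ℂ (Subalgebra.toSubmodule (invariants k r)) ≤ r.factorial := by
  let ev : Subalgebra.toSubmodule (invariants k r) →ₗ[ℂ] (Equiv.Perm (Fin r) → ℂ) :=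
    { toFun := fun M σ => M.1 (coord k 1) (coord k σ)
      map_add' := fun _ _ => rfl
      map_smul' := fun _ _ => rfl }
  have hev : Function.Injective ev := by
    intro M M' h
    refine Subtype.ext (Matrix.ext fun x z => ?_)
    obtain ⟨g, σ, rfl, rfl⟩ := exists_flagAct_eq x z
    rw [M.2, M'.2]
    exact congrFun h σ
  have := LinearMap.finrank_le_finrank_of_injective hev
  rwa [finrank_fintype_fun_eq_card, Fintype.card_perm, Fintype.card_fin] at this

end CFlag

namespace HeckeRel

variable {k : Type*} [Field k] [Fintype k] {r : ℕ}

/-- The generators of the Hecke algebra, extended by zero to all natural numbers. -/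
noncomputable def gen (q : ℂ) (r i : ℕ) : RingQuot (HeckeRel q r) :=
  if h : i < r - 1 then RingQuot.mkAlgHom ℂ (HeckeRel q r) (FreeAlgebra.ι ℂ ⟨i, h⟩) else 0

theorem gen_of_lt (q : ℂ) {r i : ℕ} (h : i < r - 1) :
    gen q r i = RingQuot.mkAlgHom ℂ (HeckeRel q r) (FreeAlgebra.ι ℂ ⟨i, h⟩) :=
  dif_pos h

theorem adjoin_gen (q : ℂ) (r : ℕ) : Algebra.adjoin ℂ (gen q r '' Set.Iio (r - 1)) = ⊤ := by
  have h := AlgHom.map_adjoin (RingQuot.mkAlgHom ℂ (HeckeRel q r))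
    (Set.range (FreeAlgebra.ι ℂ (X := Fin (r - 1))))
  rw [FreeAlgebra.adjoin_range_ι, Algebra.map_top,
    (AlgHom.range_eq_top _).mpr (RingQuot.mkAlgHom_surjective ℂ _)] at h
  rw [h]
  congr 1
  ext y
  constructor
  · rintro ⟨i, hi, rfl⟩
    exact ⟨_, ⟨⟨i, hi⟩, rfl⟩, (gen_of_lt q hi).symm⟩
  · rintro ⟨_, ⟨i, rfl⟩, rfl⟩
    exact ⟨i, i.2, gen_of_lt q i.2⟩

theorem mul_self_eq_of_quadratic {R : Type*} [Ring R] [Algebra ℂ R] {t : R} {q : ℂ}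
    (h : (t + 1) * (t - algebraMap ℂ R q) = 0) : t * t = (q - 1) • t + q • 1 := by
  rw [Algebra.algebraMap_eq_smul_one] at h
  rw [← sub_eq_zero, ← h, mul_sub, add_mul, one_mul, mul_smul_comm, mul_one, smul_add, sub_smul,
    one_smul]
  abel

theorem span_normalWord_gen (q : ℂ) (r : ℕ) :
    Submodule.span ℂ (Set.range (normalWord (gen q r) (r - 1))) = ⊤ := by
  refine span_normalWord_eq_top (q := q) (fun i j hj hij => ?_) (fun i hi => ?_) (fun i hi => ?_)
    (adjoin_gen q r)
  · rw [gen_of_lt q hj, gen_of_lt q (by omega), ← map_mul, ← map_mul]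
    exact RingQuot.mkAlgHom_rel ℂ (HeckeRel.comm _ _ (Or.inl hij))
  · rw [gen_of_lt q hi, gen_of_lt q (by omega)]
    simp only [← map_mul]
    exact RingQuot.mkAlgHom_rel ℂ (HeckeRel.braid _ _ rfl)
  · rw [gen_of_lt q hi]
    have h := RingQuot.mkAlgHom_rel ℂ (HeckeRel.quad (q := q) (r := r) ⟨i, hi⟩)
    rw [map_mul, map_add, map_sub, map_one, map_zero, AlgHom.commutes] at h
    exact mul_self_eq_of_quadratic h

/-- The action of the Hecke algebra on functions on complete flags. -/
noncomputable def toMatrix (k : Type*) [Field k] [Fintype k] (r : ℕ) :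
    RingQuot (HeckeRel (Fintype.card k : ℂ) r) →ₐ[ℂ] Matrix (CFlag k r) (CFlag k r) ℂ :=
  RingQuot.liftAlgHom ℂ ⟨FreeAlgebra.lift ℂ fun i => CFlag.adjMat k r i, by
    intro x y h
    induction h with
    | comm i j h =>
      simp only [map_mul, FreeAlgebra.lift_ι_apply]
      exact CFlag.adjMat_comm h
    | braid i j h =>
      simp only [map_mul, FreeAlgebra.lift_ι_apply, h]
      exact CFlag.adjMat_braid (by omega)
    | quad i =>
      rw [map_mul, map_add, map_sub, map_one, map_zero, AlgHom.commutes, FreeAlgebra.lift_ι_apply]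
      exact CFlag.adjMat_quad (by omega)⟩

theorem toMatrix_mkAlgHom_ι (i : Fin (r - 1)) :
    toMatrix k r (RingQuot.mkAlgHom ℂ _ (FreeAlgebra.ι ℂ i)) = CFlag.adjMat k r i := by
  rw [toMatrix, RingQuot.liftAlgHom_mkAlgHom_apply, FreeAlgebra.lift_ι_apply]

theorem toMatrix_gen (i : ℕ) :
    toMatrix k r (gen (Fintype.card k : ℂ) r i) = CFlag.adjMat k r i := by
  by_cases h : i < r - 1
  · rw [gen_of_lt _ h, toMatrix_mkAlgHom_ι]
  · rw [gen, dif_neg h, map_zero]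
    ext x y
    exact (if_neg fun ha => h (by have := CFlag.Adj.lt ha; omega)).symm

theorem toMatrix_comp_normalWord :
    toMatrix k r ∘ normalWord (gen (Fintype.card k : ℂ) r) (r - 1) =
      normalWord (CFlag.adjMat k r) (r - 1) := by
  ext1 w
  rw [Function.comp_apply, map_normalWord]
  simp only [toMatrix_gen]

theorem toMatrix_injective (hr : 1 ≤ r) : Function.Injective (toMatrix k r) := by
  have hli := CFlag.linearIndependent_normalWord (k := k) (show r - 1 < r by omega)
  rw [← toMatrix_comp_normalWord] at hli
  rw [injective_iff_map_eq_zero]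
  intro h h0
  have hmem : h ∈ Submodule.span ℂ (Set.range (normalWord (gen (Fintype.card k : ℂ) r) (r - 1))) :=
    span_normalWord_gen _ r ▸ Submodule.mem_top
  obtain ⟨c, rfl⟩ := (Submodule.mem_span_range_iff_exists_fun ℂ).mp hmem
  rw [map_sum] at h0
  simp only [map_smul] at h0
  have hc := Fintype.linearIndependent_iff.mp hli c h0
  simp [hc]

theorem range_toMatrix (hr : 1 ≤ r) : (toMatrix k r).range = CFlag.invariants k r := by
  have hle : (toMatrix k r).range ≤ CFlag.invariants k r := by
    rw [← Algebra.map_top, ← adjoin_gen, AlgHom.map_adjoin, Algebra.adjoin_le_iff]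
    rintro _ ⟨_, ⟨i, -, rfl⟩, rfl⟩
    rw [toMatrix_gen]
    exact CFlag.adjMat_mem_invariants i
  refine Subalgebra.toSubmodule_injective (Submodule.eq_of_le_of_finrank_le hle ?_)
  refine CFlag.finrank_invariants_le.trans ?_
  have hli := CFlag.linearIndependent_normalWord (k := k) (show r - 1 < r by omega)
  have hcard := finrank_span_eq_card hli
  rw [NormalIdx.card, Nat.sub_add_cancel hr] at hcard
  rw [← hcard]
  refine Submodule.finrank_mono (Submodule.span_le.mpr ?_)
  rw [← toMatrix_comp_normalWord]
  rintro _ ⟨w, rfl⟩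
  exact ⟨_, rfl⟩

end HeckeRel

/-- Iwahori–Matsumoto theorem (finite case, specialized at `v⁻² = q`): for
`k = F_q` and `G = GL_r(k)`, the assignment `T_i ↦ 1_{O_{s_i}}` extends to an
isomorphism of `ℂ`-algebras from the Hecke algebra `H_r(q)` onto the
convolution algebra `ℂ_G[𝔅 × 𝔅]` of `G`-invariant functions on pairs of
complete flags.  (The isomorphism is expressed as a bijective `ℂ`-linear map
onto the space of invariant functions, which is unital and multiplicative for
the convolution product.) -/
theorem iwahori_matsumoto_finite
    (k : Type*) [Field k] [Fintype k] (r : ℕ) (hr : 1 ≤ r) :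
    ∃ Φ : RingQuot (HeckeRel (Fintype.card k : ℂ) r) →ₗ[ℂ]
        (CFlag k r × CFlag k r → ℂ),
      Function.Injective Φ ∧
      (Set.range Φ = {f : CFlag k r × CFlag k r → ℂ |
        ∀ (g : (Fin r → k) ≃ₗ[k] (Fin r → k)) (U U' : CFlag k r),
          f (flagAct g U, flagAct g U') = f (U, U')}) ∧
      (∀ x y, Φ (x * y) = conv (Φ x) (Φ y)) ∧
      (Φ 1 = fun p => if p.1 = p.2 then 1 else 0) ∧
      ∀ i : Fin (r - 1),
        Φ (RingQuot.mkAlgHom ℂ (HeckeRel (Fintype.card k : ℂ) r)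
            (FreeAlgebra.ι ℂ i))
          = fun p => if (∀ j : Fin (r + 1), (j : ℕ) ≠ (i : ℕ) + 1 →
                p.1.1 j = p.2.1 j) ∧ p.1 ≠ p.2 then 1 else 0 := by
  refine ⟨(LinearEquiv.curry ℂ ℂ (CFlag k r) (CFlag k r)).symm.toLinearMap ∘ₗ
    (HeckeRel.toMatrix k r).toLinearMap, ?_, ?_, fun x y => ?_, ?_, fun i => ?_⟩
  · exact (LinearEquiv.curry ℂ ℂ (CFlag k r) (CFlag k r)).symm.injective.comp
      (HeckeRel.toMatrix_injective hr)
  · ext f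
    have h := SetLike.ext_iff.mp (HeckeRel.range_toMatrix (k := k) hr) (Function.curry f)
    constructor
    · rintro ⟨x, rfl⟩
      exact h.mp ⟨x, rfl⟩
    · intro hf
      obtain ⟨x, hx⟩ := h.mpr hf
      exact ⟨x, congrArg Function.uncurry hx⟩
  · ext ⟨U, U'⟩
    change HeckeRel.toMatrix k r (x * y) U U' = ∑ᶠ W, _
    rw [map_mul, Matrix.mul_apply, finsum_eq_sum_of_fintype]
    rfl
  · ext ⟨U, U'⟩
    change HeckeRel.toMatrix k r 1 U U' = _
    rw [map_one, Matrix.one_apply]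
  · ext ⟨U, U'⟩
    change HeckeRel.toMatrix k r _ U U' = _
    rw [HeckeRel.toMatrix_mkAlgHom_ι, CFlag.adjMat, relMatrix_apply]
    refine if_congr (and_congr_left fun _ => ⟨fun h j hj => ?_, fun h m hm => ?_⟩) rfl rfl
    · rw [← CFlag.sub_val, ← CFlag.sub_val, h j hj]
    · rcases le_total r m with hrm | hrm
      · rw [CFlag.sub_of_le _ hrm, CFlag.sub_of_le _ hrm]
      · have := h ⟨m, by omega⟩ hm
        rwa [← CFlag.sub_val, ← CFlag.sub_val] at this
end

section
/- Let q be a prime power, k = F_q, V = k^r, G = GL_r(k). Let 𝔅 be the set of complete flags in V, and let F = ⊔_d F_d be the disjoint union of the n-step partial flag varieties F_d over all compositions d = (d_1,…,d_n) of r into n parts. Convolution makes ℂ_G[F × F] and ℂ_G[𝔅 × 𝔅] associative unital ℂ-algebras and makes ℂ_G[F × 𝔅] a left ℂ_G[F × F]-module and a right ℂ_G[𝔅 × 𝔅]-module, with commuting actions. Then the left action map ℂ_G[F × F] → End_{ℂ_G[𝔅 × 𝔅]}(ℂ_G[F × 𝔅]) is an isomorphism of ℂ-algebras. (Geometric form of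 the identification of the q-Schur algebra S_{n,r} with End_{H_r}(V_q^{⊗ r}).) -/
open Module LinearMap Finset
open scoped Classical

/-- The set `F = ⊔_d F_d` of all `n`-step partial flags in `V = k^r`
(the disjoint union of the partial flag varieties over all compositions `d`
of `r` into `n` parts). -/
def NFlag (k : Type*) [Field k] (r n : ℕ) : Type _ :=
  {L : Fin (n + 1) → Submodule k (Fin r → k) //
    (∀ i j, i ≤ j → L i ≤ L j) ∧ L 0 = ⊥ ∧ L (Fin.last n) = ⊤}

/-- The action of `GL(V)` on complete flags. -/
def cAct {k : Type*} [Field k] {r : ℕ}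
    (g : (Fin r → k) ≃ₗ[k] (Fin r → k)) (U : CFlag k r) : CFlag k r :=
  ⟨fun i => (U.1 i).map g.toLinearMap,
    fun i j h => Submodule.map_mono (U.2.1 i j h),
    fun i => by rw [LinearEquiv.finrank_map_eq]; exact U.2.2 i⟩

/-- The action of `GL(V)` on `n`-step partial flags. -/
def nAct {k : Type*} [Field k] {r n : ℕ}
    (g : (Fin r → k) ≃ₗ[k] (Fin r → k)) (L : NFlag k r n) : NFlag k r n :=
  ⟨fun i => (L.1 i).map g.toLinearMap,
    fun i j h => Submodule.map_mono (L.2.1 i j h),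
    by show (L.1 0).map _ = ⊥
       rw [L.2.2.1]; exact Submodule.map_bot _,
    by show (L.1 (Fin.last n)).map _ = ⊤
       rw [L.2.2.2, Submodule.map_top, LinearMap.range_eq_top]
       exact g.surjective⟩

section

variable (k : Type*) [Field k] (r n : ℕ)

/-- `G`-invariant functions on `F × F`. -/
def InvFF : Set (NFlag k r n × NFlag k r n → ℂ) :=
  {f | ∀ (g : (Fin r → k) ≃ₗ[k] (Fin r → k)) (L L' : NFlag k r n),
    f (nAct g L, nAct g L') = f (L, L')}

/-- `G`-invariant functions on `F × 𝔅`. -/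
def InvFB : Set (NFlag k r n × CFlag k r → ℂ) :=
  {f | ∀ (g : (Fin r → k) ≃ₗ[k] (Fin r → k)) (L : NFlag k r n) (U : CFlag k r),
    f (nAct g L, cAct g U) = f (L, U)}

/-- `G`-invariant functions on `𝔅 × 𝔅`. -/
def InvBB : Set (CFlag k r × CFlag k r → ℂ) :=
  {f | ∀ (g : (Fin r → k) ≃ₗ[k] (Fin r → k)) (U U' : CFlag k r),
    f (cAct g U, cAct g U') = f (U, U')}

end

section Convolution

variable {α β γ δ ι : Type*}

theorem conv_apply [Fintype β] (f : α × β → ℂ) (g : β × γ → ℂ) (a : α) (c : γ) :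
    conv f g (a, c) = ∑ y, f (a, y) * g (y, c) :=
  finsum_eq_sum_of_fintype _

theorem conv_assoc [Finite β] [Finite γ] (f : α × β → ℂ) (g : β × γ → ℂ) (h : γ × δ → ℂ) :
    conv (conv f g) h = conv f (conv g h) := by
  have := Fintype.ofFinite β
  have := Fintype.ofFinite γ
  ext ⟨a, d⟩
  simp only [conv_apply, Finset.sum_mul, Finset.mul_sum, mul_assoc]
  exact Finset.sum_comm

theorem conv_sum_left [Finite β] (s : Finset ι) (f : ι → α × β → ℂ) (g : β × γ → ℂ) :
    conv (∑ t ∈ s, f t) g = ∑ t ∈ s, conv (f t) g := by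
  have := Fintype.ofFinite β
  ext ⟨a, c⟩
  simp only [conv_apply, Finset.sum_apply, Finset.sum_mul]
  exact Finset.sum_comm

theorem conv_sum_right [Finite β] (s : Finset ι) (f : α × β → ℂ) (g : ι → β × γ → ℂ) :
    conv f (∑ t ∈ s, g t) = ∑ t ∈ s, conv f (g t) := by
  have := Fintype.ofFinite β
  ext ⟨a, c⟩
  simp only [conv_apply, Finset.sum_apply, Finset.mul_sum]
  exact Finset.sum_comm

theorem conv_diag_left [Finite α] (m : α × β → ℂ) :
    conv (fun p : α × α => if p.1 = p.2 then (1 : ℂ) else 0) m = m := by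
  have := Fintype.ofFinite α
  ext ⟨a, b⟩
  simp [conv_apply]

theorem conv_diag_right [Finite β] (m : α × β → ℂ) :
    conv m (fun p : β × β => if p.1 = p.2 then (1 : ℂ) else 0) = m := by
  have := Fintype.ofFinite β
  ext ⟨a, b⟩
  simp [conv_apply]

theorem conv_eq_of_bijective {f : α × β → ℂ} {g : β × γ → ℂ} {a a' : α} {c c' : γ}
    (e : β → β) (he : Function.Bijective e) (hf : ∀ y, f (a', e y) = f (a, y))
    (hg : ∀ y, g (e y, c') = g (y, c)) : conv f g (a', c') = conv f g (a, c) :=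
  (finsum_eq_of_bijective e he fun y => by simp only [hf, hg]).symm

end Convolution

section Flags

variable {k : Type*} [Field k] {r n : ℕ}

instance [Finite k] : Finite (CFlag k r) :=
  inferInstanceAs (Finite {U : Fin (r + 1) → Submodule k (Fin r → k) //
    (∀ i j, i ≤ j → U i ≤ U j) ∧ ∀ i, finrank k (U i) = (i : ℕ)})

instance [Finite k] : Finite (NFlag k r n) :=
  inferInstanceAs (Finite {L : Fin (n + 1) → Submodule k (Fin r → k) //
    (∀ i j, i ≤ j → L i ≤ L j) ∧ L 0 = ⊥ ∧ L (Fin.last n) = ⊤})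

theorem cAct_injective (g : (Fin r → k) ≃ₗ[k] (Fin r → k)) :
    Function.Injective (cAct g) := fun _ _ h =>
  Subtype.ext <| funext fun i =>
    Submodule.map_injective_of_injective g.injective (congrFun (congrArg Subtype.val h) i)

theorem nAct_injective (g : (Fin r → k) ≃ₗ[k] (Fin r → k)) :
    Function.Injective (nAct (n := n) g) := fun _ _ h =>
  Subtype.ext <| funext fun i =>
    Submodule.map_injective_of_injective g.injective (congrFun (congrArg Subtype.val h) i)

theorem cAct_bijective [Finite k] (g : (Fin r → k) ≃ₗ[k] (Fin r → k)) :
    Function.Bijective (cAct g) :=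
  Finite.injective_iff_bijective.mp (cAct_injective g)

theorem nAct_bijective [Finite k] (g : (Fin r → k) ≃ₗ[k] (Fin r → k)) :
    Function.Bijective (nAct (n := n) g) :=
  Finite.injective_iff_bijective.mp (nAct_injective g)

theorem NFlag.exists_extend_step (L : NFlag k r n) {j : ℕ} (hj : j < r)
    {W : Submodule k (Fin r → k)} (hW : finrank k W = j)
    (hWL : ∀ i, j ≤ finrank k (L.1 i) → W ≤ L.1 i) :
    ∃ W', W ≤ W' ∧ finrank k W' = j + 1 ∧
      ∀ i, j + 1 ≤ finrank k (L.1 i) → W' ≤ L.1 i := by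
  have hne : ∃ i, j + 1 ≤ finrank k (L.1 i) :=
    ⟨Fin.last n, by rw [L.2.2.2, finrank_top]; simpa using hj⟩
  obtain ⟨i₀, h₀, hmin⟩ := WellFounded.has_min (wellFounded_lt (α := Fin (n + 1)))
    {i | j + 1 ≤ finrank k (L.1 i)} hne
  have h₀ : j + 1 ≤ finrank k (L.1 i₀) := h₀
  have hlt : W < L.1 i₀ := lt_of_le_of_ne (hWL i₀ (by omega)) (by rintro rfl; omega)
  obtain ⟨v, hv, hvW⟩ := SetLike.exists_of_lt hlt
  refine ⟨W ⊔ Submodule.span k {v}, le_sup_left, ?_, fun i hi => ?_⟩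
  · rw [Submodule.finrank_sup_span_singleton hvW, hW]
  · have : i₀ ≤ i := not_lt.mp (hmin i hi)
    exact (sup_le hlt.le ((Submodule.span_singleton_le_iff_mem _ _).mpr hv)).trans
      (L.2.1 _ _ this)

/-- Every partial flag is refined by a complete flag. -/
theorem NFlag.exists_refinement (L : NFlag k r n) :
    ∃ (t : Fin (n + 1) → Fin (r + 1)) (U : CFlag k r), ∀ i, U.1 (t i) = L.1 i := by
  have step : ∀ (j : ℕ) (W : Submodule k (Fin r → k)), ∃ W', W ≤ W' ∧
      (j < r → finrank k W = j → (∀ i, j ≤ finrank k (L.1 i) → W ≤ L.1 i) →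
        finrank k W' = j + 1 ∧ ∀ i, j + 1 ≤ finrank k (L.1 i) → W' ≤ L.1 i) := by
    intro j W
    by_cases h : j < r ∧ finrank k W = j ∧ ∀ i, j ≤ finrank k (L.1 i) → W ≤ L.1 i
    · obtain ⟨W', h₁, h₂⟩ := L.exists_extend_step h.1 h.2.1 h.2.2
      exact ⟨W', h₁, fun _ _ _ => h₂⟩
    · exact ⟨W, le_rfl, fun h₁ h₂ h₃ => (h ⟨h₁, h₂, h₃⟩).elim⟩
  choose F hF hF' using step
  let U : ℕ → Submodule k (Fin r → k) := fun j =>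
    Nat.rec (motive := fun _ => Submodule k (Fin r → k)) ⊥ F j
  have hmono : Monotone U := monotone_nat_of_le_succ fun j => hF j (U j)
  have hU : ∀ j ≤ r, finrank k ↥(U j) = j ∧ ∀ i, j ≤ finrank k (L.1 i) → U j ≤ L.1 i := by
    intro j
    induction j with
    | zero => exact fun _ => ⟨finrank_bot k _, fun _ _ => bot_le⟩
    | succ j ih => exact fun hj => hF' j (U j) hj (ih (by omega)).1 (ih (by omega)).2
  have hd : ∀ i, finrank k (L.1 i) ≤ r := fun i => by
    simpa using Submodule.finrank_le (L.1 i)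
  exact ⟨fun i => ⟨finrank k (L.1 i), Nat.lt_succ_of_le (hd i)⟩,
    ⟨fun j => U j, fun i j h => hmono h, fun i => (hU i (Nat.le_of_lt_succ i.2)).1⟩,
    fun i => Submodule.eq_of_le_of_finrank_eq ((hU _ (hd i)).2 i le_rfl) (hU _ (hd i)).1⟩

/-- The indicator function of the pairs `(L, U)` such that the `i`-th step of `L` is the
`t i`-th step of `U` for all `i`. -/
noncomputable def refineInd (t : Fin (n + 1) → Fin (r + 1)) : NFlag k r n × CFlag k r → ℂ :=
  fun p => if ∀ i, p.2.1 (t i) = p.1.1 i then 1 else 0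

/-- The transpose of `refineInd t`, normalized by the number of refinements. -/
noncomputable def refineAvg (t : Fin (n + 1) → Fin (r + 1)) : CFlag k r × NFlag k r n → ℂ :=
  fun p => refineInd t (p.2, p.1) / ∑ᶠ U, refineInd t (p.2, U)

theorem refineInd_act (t : Fin (n + 1) → Fin (r + 1)) (g : (Fin r → k) ≃ₗ[k] (Fin r → k))
    (L : NFlag k r n) (U : CFlag k r) :
    refineInd t (nAct g L, cAct g U) = refineInd t (L, U) := by
  have h : ∀ i, (cAct g U).1 (t i) = (nAct g L).1 i ↔ U.1 (t i) = L.1 i := fun i =>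
    (Submodule.map_injective_of_injective g.injective).eq_iff
  simp only [refineInd, h]

theorem refineAvg_act [Finite k] (t : Fin (n + 1) → Fin (r + 1))
    (g : (Fin r → k) ≃ₗ[k] (Fin r → k)) (U : CFlag k r) (L : NFlag k r n) :
    refineAvg t (cAct g U, nAct g L) = refineAvg t (U, L) := by
  have h : ∑ᶠ U, refineInd t (nAct g L, U) = ∑ᶠ U, refineInd t (L, U) :=
    (finsum_eq_of_bijective (cAct g) (cAct_bijective g)
      fun U => (refineInd_act t g L U).symm).symm
  simp only [refineAvg, refineInd_act, h]

theorem type_eq_of_refines {t t' : Fin (n + 1) → Fin (r + 1)} {L : NFlag k r n}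
    {U U' : CFlag k r} (h : ∀ i, U.1 (t i) = L.1 i) (h' : ∀ i, U'.1 (t' i) = L.1 i) :
    t = t' :=
  funext fun i => Fin.ext <| by rw [← U.2.2 (t i), ← U'.2.2 (t' i), h, h']

theorem sum_conv_refineInd_refineAvg [Finite k] :
    ∑ t, conv (refineInd t) (refineAvg t) =
      fun p : NFlag k r n × NFlag k r n => if p.1 = p.2 then (1 : ℂ) else 0 := by
  have := Fintype.ofFinite (CFlag k r)
  ext ⟨L, L'⟩
  simp only [Finset.sum_apply, conv_apply]
  split_ifs with hL
  · subst hL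
    obtain ⟨t₀, U₀, h₀⟩ := L.exists_refinement
    have hsq : ∀ t (U : CFlag k r), refineInd t (L, U) * refineAvg t (U, L) =
        refineInd t (L, U) / ∑ U, refineInd t (L, U) := by
      intro t U
      rw [refineAvg, finsum_eq_sum_of_fintype, ← mul_div_assoc]
      congr 1
      simp [refineInd]
    simp only [hsq, ← Finset.sum_div]
    rw [Finset.sum_eq_single t₀]
    · refine div_self ?_
      simp only [refineInd, Finset.sum_boole, Nat.cast_ne_zero]
      exact Finset.card_ne_zero.mpr ⟨U₀, by simpa using h₀⟩
    · intro t _ ht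
      rw [Finset.sum_eq_zero, zero_div]
      exact fun U _ => if_neg fun h => ht (type_eq_of_refines h h₀)
    · simp
  · refine Finset.sum_eq_zero fun t _ => Finset.sum_eq_zero fun U _ => ?_
    by_contra h
    have h₁ : refineInd t (L, U) ≠ 0 := left_ne_zero_of_mul h
    have h₂ : refineInd t (L', U) ≠ 0 := (div_ne_zero_iff.mp (right_ne_zero_of_mul h)).1
    simp only [refineInd, ne_eq, ite_eq_right_iff, one_ne_zero, imp_false, not_not] at h₁ h₂
    exact hL (Subtype.ext <| funext fun i => (h₁ i).symm.trans (h₂ i))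

/-- A function on `F × γ` is recovered from its convolutions with `refineAvg`. -/
theorem sum_conv_refineInd_conv [Finite k] {γ : Type*} (m : NFlag k r n × γ → ℂ) :
    ∑ t, conv (refineInd t) (conv (refineAvg t) m) = m := by
  simp only [← conv_assoc]
  rw [← conv_sum_left, sum_conv_refineInd_refineAvg, conv_diag_left]

theorem sum_conv_conv_refineInd [Finite k] {α : Type*} (f : α × NFlag k r n → ℂ) :
    ∑ t, conv (conv f (refineInd t)) (refineAvg t) = f := by
  simp only [conv_assoc]
  rw [← conv_sum_right, sum_conv_refineInd_refineAvg, conv_diag_right]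

end Flags

/-- Geometric Schur–Weyl duality / the double-centralizer property for the
convolution algebras of `G = GL_r(F_q)` acting on (pairs of) partial and
complete flag varieties: convolution makes `ℂ_G[F × F]` and `ℂ_G[𝔅 × 𝔅]`
unital associative algebras acting (on the left, resp. on the right, with
commuting actions) on `ℂ_G[F × 𝔅]`, and the left action map
`ℂ_G[F × F] → End_{ℂ_G[𝔅 × 𝔅]}(ℂ_G[F × 𝔅])` is an isomorphism of
`ℂ`-algebras: every `ℂ`-linear operator on `ℂ_G[F × 𝔅]` commuting with the
right `ℂ_G[𝔅 × 𝔅]`-action is left convolution by a unique element of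
`ℂ_G[F × F]`. -/
theorem schur_algebra_as_bicommutant
    (k : Type*) [Field k] [Fintype k] (r n : ℕ) (hr : 1 ≤ r) (hn : 1 ≤ n) :
    -- closure of the invariant subspaces under convolution
    (∀ f g, f ∈ InvFF k r n → g ∈ InvFF k r n → conv f g ∈ InvFF k r n) ∧
    (∀ f g, f ∈ InvBB k r → g ∈ InvBB k r → conv f g ∈ InvBB k r) ∧
    (∀ f m, f ∈ InvFF k r n → m ∈ InvFB k r n → conv f m ∈ InvFB k r n) ∧
    (∀ m h, m ∈ InvFB k r n → h ∈ InvBB k r → conv m h ∈ InvFB k r n) ∧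
    -- associativity (in particular the two actions on `ℂ_G[F × 𝔅]` commute,
    -- and the left action map is multiplicative)
    (∀ (f g : NFlag k r n × NFlag k r n → ℂ) (h : NFlag k r n × NFlag k r n → ℂ),
      conv (conv f g) h = conv f (conv g h)) ∧
    (∀ (f g h : CFlag k r × CFlag k r → ℂ),
      conv (conv f g) h = conv f (conv g h)) ∧
    (∀ (f g : NFlag k r n × NFlag k r n → ℂ) (m : NFlag k r n × CFlag k r → ℂ),
      conv (conv f g) m = conv f (conv g m)) ∧
    (∀ (f : NFlag k r n × NFlag k r n → ℂ) (m : NFlag k r n × CFlag k r → ℂ)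
        (h : CFlag k r × CFlag k r → ℂ),
      conv (conv f m) h = conv f (conv m h)) ∧
    (∀ (m : NFlag k r n × CFlag k r → ℂ) (h h' : CFlag k r × CFlag k r → ℂ),
      conv (conv m h) h' = conv m (conv h h')) ∧
    -- the diagonal indicator functions are units
    (∀ m : NFlag k r n × CFlag k r → ℂ,
      conv (fun p : NFlag k r n × NFlag k r n =>
        if p.1 = p.2 then (1 : ℂ) else 0) m = m ∧
      conv m (fun p : CFlag k r × CFlag k r =>
        if p.1 = p.2 then (1 : ℂ) else 0) = m) ∧
    -- the double-centralizer property
    ∀ T : (NFlag k r n × CFlag k r → ℂ) → (NFlag k r n × CFlag k r → ℂ),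
      (∀ a b, T (a + b) = T a + T b) →
      (∀ (c : ℂ) a, T (c • a) = c • T a) →
      (∀ m, m ∈ InvFB k r n → T m ∈ InvFB k r n) →
      (∀ m, m ∈ InvFB k r n → ∀ h, h ∈ InvBB k r →
        T (conv m h) = conv (T m) h) →
      ∃! f : NFlag k r n × NFlag k r n → ℂ,
        f ∈ InvFF k r n ∧ ∀ m, m ∈ InvFB k r n → T m = conv f m := by
  refine ⟨fun f g hf hg a L L' =>
      conv_eq_of_bijective (nAct a) (nAct_bijective a) (hf a L) fun y => hg a y L',
    fun f g hf hg a U U' =>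
      conv_eq_of_bijective (cAct a) (cAct_bijective a) (hf a U) fun y => hg a y U',
    fun f m hf hm a L U =>
      conv_eq_of_bijective (nAct a) (nAct_bijective a) (hf a L) fun y => hm a y U,
    fun m h hm hh a L U =>
      conv_eq_of_bijective (cAct a) (cAct_bijective a) (hm a L) fun y => hh a y U,
    conv_assoc, conv_assoc, conv_assoc, conv_assoc, conv_assoc,
    fun m => ⟨conv_diag_left m, conv_diag_right m⟩, ?_⟩
  intro T hadd _ hinv hcomm
  have hP : ∀ t, refineInd t ∈ InvFB k r n := refineInd_act
  refine ⟨∑ t, conv (T (refineInd t)) (refineAvg t), ⟨fun a L L' => ?_, fun m hm => ?_⟩, ?_⟩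
  · simp only [Finset.sum_apply]
    exact Finset.sum_congr rfl fun t _ =>
      conv_eq_of_bijective (cAct a) (cAct_bijective a) (hinv _ (hP t) a L)
        fun y => refineAvg_act t a y L'
  · have hQ : ∀ t, conv (refineAvg t) m ∈ InvBB k r := fun t a U U' =>
      conv_eq_of_bijective (nAct a) (nAct_bijective a) (refineAvg_act t a U) fun y => hm a y U'
    calc T m = T (∑ t, conv (refineInd t) (conv (refineAvg t) m)) := by
          rw [sum_conv_refineInd_conv]
      _ = ∑ t, T (conv (refineInd t) (conv (refineAvg t) m)) :=
          map_sum (AddMonoidHom.mk' T hadd) _ _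
      _ = ∑ t, conv (conv (T (refineInd t)) (refineAvg t)) m :=
          Finset.sum_congr rfl fun t _ => by rw [hcomm _ (hP t) _ (hQ t), conv_assoc]
      _ = conv (∑ t, conv (T (refineInd t)) (refineAvg t)) m := (conv_sum_left _ _ _).symm
  · rintro f ⟨-, hf⟩
    calc f = ∑ t, conv (conv f (refineInd t)) (refineAvg t) := (sum_conv_conv_refineInd f).symm
      _ = ∑ t, conv (T (refineInd t)) (refineAvg t) :=
          Finset.sum_congr rfl fun t _ => by rw [hf _ (hP t)]
end

section
/- Let V be a finite-dimensional complex vector space and r ≥ 1. Let ρ : ℂ[𝔖_r] → End_ℂ(V^{⊗ r}) be the algebra homomorphism induced by the permutation action σ·(v_1 ⊗ ⋯ ⊗ v_r) = v_{σ^{−1}(1)} ⊗ ⋯ ⊗ v_{σ^{−1}(r)}. Then the image of ρ equals the commutant { f ∈ End_ℂ(V^{⊗ r}) : f ∘ g^{⊗ r} = g^{⊗ r} ∘ f for all g ∈ GL(V) } of the diagonal GL(V)-action; and if dim V ≥ r then ρ is injective, so ℂ[𝔖_r] ≅ End_{GL(V)}(V^{⊗ r}). (Schur–Weyl duality, first half.)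 -/
open Module LinearMap Finset

open scoped TensorProduct

/-- The permutation operator `P_σ : v_1 ⊗ ⋯ ⊗ v_r ↦ v_{σ⁻¹(1)} ⊗ ⋯ ⊗ v_{σ⁻¹(r)}`
on the `r`-th tensor power of `V`. -/
noncomputable def permOp (V : Type*) [AddCommGroup V] [Module ℂ V] (r : ℕ)
    (σ : Equiv.Perm (Fin r)) :
    Module.End ℂ (⨂[ℂ] _ : Fin r, V) :=
  (PiTensorProduct.reindex ℂ (fun _ : Fin r => V) σ).toLinearMap

/-- The diagonal operator `g^{⊗ r} : v_1 ⊗ ⋯ ⊗ v_r ↦ g v_1 ⊗ ⋯ ⊗ g v_r`. -/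
noncomputable def tensorPow (V : Type*) [AddCommGroup V] [Module ℂ V] (r : ℕ)
    (g : V ≃ₗ[ℂ] V) :
    Module.End ℂ (⨂[ℂ] _ : Fin r, V) :=
  PiTensorProduct.map fun _ : Fin r => (g : V →ₗ[ℂ] V)

/-- Polarization: the symmetrization of a multilinear map is a signed sum of diagonal values. -/
theorem MultilinearMap.sum_neg_one_pow_card_smul_map_const {R ι M N : Type*} [CommRing R]
    [Fintype ι] [DecidableEq ι] [AddCommGroup M] [Module R M] [AddCommGroup N] [Module R N]
    (m : MultilinearMap R (fun _ : ι => M) N) (x : ι → M) :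
    ∑ s : Finset ι, (-1 : R) ^ #s • m (fun _ => ∑ i ∈ s, x i) =
      (-1 : R) ^ Fintype.card ι • ∑ σ : Equiv.Perm ι, m fun i => x (σ i) := by
  have expand (s : Finset ι) : m (fun _ => ∑ i ∈ s, x i) =
      ∑ k : ι → ι, if ∀ i, k i ∈ s then m (fun i => x (k i)) else 0 := by
    rw [m.map_sum_finset (fun _ => x) (fun _ => s), ← Finset.sum_filter]
    congr 1
    ext k
    simp
  have cancel (k : ι → ι) (hk : ¬ Function.Surjective k) :
      ∑ s : Finset ι, (-1 : R) ^ #s • (if ∀ i, k i ∈ s then m (fun i => x (k i)) else 0) = 0 := by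
    obtain ⟨j, hj⟩ : ∃ j, ∀ i, k i ≠ j := by simpa [Function.Surjective] using hk
    refine Finset.sum_involution (fun s _ => symmDiff s {j}) ?_ ?_ (by simp) ?_
    · intro s _
      have hmem (i : ι) : k i ∈ symmDiff s {j} ↔ k i ∈ s := by
        simp [Finset.mem_symmDiff, hj i]
      simp only [hmem]
      rw [← add_smul]
      convert zero_smul R _
      by_cases h : j ∈ s
      · have : symmDiff s {j} = s.erase j := by
          ext a
          simp only [Finset.mem_symmDiff, Finset.mem_singleton, Finset.mem_erase]
          grind
        rw [this, ← Finset.card_erase_add_one h, pow_succ]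
        ring
      · have : symmDiff s {j} = insert j s := by
          ext a
          simp only [Finset.mem_symmDiff, Finset.mem_singleton, Finset.mem_insert]
          grind
        rw [this, Finset.card_insert_of_notMem h, pow_succ]
        ring
    · intro s _ _ h
      have := congr(j ∈ $h)
      simp [Finset.mem_symmDiff] at this
    · intro s _
      simp
  simp_rw [expand, Finset.smul_sum]
  rw [Finset.sum_comm, ← Finset.sum_subset
    (Finset.subset_univ (Finset.univ.filter fun k : ι → ι => Function.Bijective k))]
  · refine Finset.sum_bij' (fun k hk => Equiv.ofBijective k (Finset.mem_filter.mp hk).2)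
      (fun σ _ => σ) (by simp) (fun σ _ => by simp) (fun _ _ => rfl)
      (fun σ _ => by ext; rfl) ?_
    intro k hk
    rw [Finset.sum_eq_single Finset.univ]
    · simp
    · intro s _ hs
      rw [if_neg, smul_zero]
      intro h
      exact hs (Finset.eq_univ_of_forall fun j => by
        obtain ⟨i, rfl⟩ := (Finset.mem_filter.mp hk).2.2 j
        exact h i)
    · simp
  · intro k _ hk
    refine cancel k fun h => hk ?_
    simpa using Finite.injective_iff_bijective.mp (Finite.injective_iff_surjective.mpr h)

/-- The double centralizer theorem for a finite group representation. -/
theorem Representation.mem_span_range_of_commute {k G W : Type*} [Field k] [Group G] [Finite G]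
    [NeZero (Nat.card G : k)] [AddCommGroup W] [Module k W] [FiniteDimensional k W]
    (ρ : Representation k G W) (f : Module.End k W)
    (hf : ∀ T : Module.End k W, (∀ g, Commute T (ρ g)) → Commute f T) :
    f ∈ Submodule.span k (Set.range ρ) := by
  let F : Module.End (Module.End (MonoidAlgebra k G) ρ.asModule) ρ.asModule :=
    { toFun := fun w => ρ.asModuleEquiv.symm (f (ρ.asModuleEquiv w))
      map_add' := by simp
      map_smul' := by
        intro φ w
        let T : Module.End k W := ρ.asModuleEquiv.toLinearMap ∘ₗ φ.restrictScalars k ∘ₗ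
          ρ.asModuleEquiv.symm.toLinearMap
        have hT : Commute f T := hf T fun g => by
          ext v
          have := congr(ρ.asModuleEquiv
            $(φ.map_smul (MonoidAlgebra.of k G g) (ρ.asModuleEquiv.symm v)))
          rwa [← asModuleEquiv_symm_map_rho, asModuleEquiv_map_smul, asAlgebraHom_of] at this
        have := congr($hT.eq (ρ.asModuleEquiv w))
        simpa [T] using congr(ρ.asModuleEquiv.symm $this) }
  let b := Module.finBasis k W
  classical
  obtain ⟨a, ha⟩ := jacobson_density F (Finset.univ.image fun i => ρ.asModuleEquiv.symm (b i))
  have hfa : f = ρ.asAlgebraHom a := b.ext fun i => by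
    have := ha (ρ.asModuleEquiv.symm (b i)) (by simp)
    simpa [F, asModuleEquiv_map_smul] using congr(ρ.asModuleEquiv $this)
  rw [hfa, asAlgebraHom_def, MonoidAlgebra.lift_apply]
  exact Submodule.sum_mem _ fun g _ =>
    Submodule.smul_mem _ _ (Submodule.subset_span ⟨g, rfl⟩)

/-- A polynomial curve that lies in a subspace for all but finitely many parameters lies in it for
every parameter. -/
theorem Submodule.sum_pow_smul_mem_of_finite {k W ι : Type*} [Field k] [Infinite k]
    [AddCommGroup W] [Module k W] (C : Submodule k W) (s : Finset ι) (n : ι → ℕ) (w : ι → W)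
    (h : {t : k | ∑ i ∈ s, t ^ n i • w i ∉ C}.Finite) (t : k) :
    ∑ i ∈ s, t ^ n i • w i ∈ C := by
  by_contra ht
  obtain ⟨φ, hφ, hC⟩ := C.exists_le_ker_of_notMem ht
  let p : Polynomial k := ∑ i ∈ s, Polynomial.C (φ (w i)) * Polynomial.X ^ n i
  have hp (u : k) : p.eval u = φ (∑ i ∈ s, u ^ n i • w i) := by
    simp only [p, Polynomial.eval_finsetSum, Polynomial.eval_mul, Polynomial.eval_C,
      Polynomial.eval_pow, Polynomial.eval_X, map_sum, map_smul, smul_eq_mul, mul_comm]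
  have hp0 : p = 0 := Polynomial.eq_zero_of_infinite_isRoot p <|
    h.infinite_compl.mono fun u hu => by
      rw [Set.mem_ofPred_eq, Polynomial.IsRoot.def, hp]
      exact hC (by simpa using hu)
  exact hφ (by rw [← hp, hp0, Polynomial.eval_zero])

/-- A subspace containing all `g^{⊗ r}` with `g` invertible contains all `h^{⊗ r}`. -/
theorem map_const_mem_of_tensorPow_mem {V : Type*} [AddCommGroup V] [Module ℂ V]
    [FiniteDimensional ℂ V] {r : ℕ} (C : Submodule ℂ (Module.End ℂ (⨂[ℂ] _ : Fin r, V)))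
    (hC : ∀ g : V ≃ₗ[ℂ] V, tensorPow V r g ∈ C) (h : Module.End ℂ V) :
    PiTensorProduct.map (fun _ : Fin r => h) ∈ C := by
  have expand (t : ℂ) : PiTensorProduct.map (fun _ : Fin r => h + t • (1 : Module.End ℂ V)) =
      ∑ s : Finset (Fin r), t ^ #s •
        PiTensorProduct.map (s.piecewise (fun _ => 1) fun _ : Fin r => h) := by
    have := (PiTensorProduct.mapMultilinear ℂ (fun _ : Fin r => V) (fun _ => V)).map_add_univ
      (fun _ => t • (1 : Module.End ℂ V)) (fun _ => h)
    simp only [PiTensorProduct.mapMultilinear_apply] at this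
    rw [show (fun _ : Fin r => h + t • (1 : Module.End ℂ V)) =
      (fun _ => t • (1 : Module.End ℂ V)) + fun _ => h by ext; simp [add_comm], this]
    refine Finset.sum_congr rfl fun s _ => ?_
    have hs := (PiTensorProduct.mapMultilinear ℂ (fun _ : Fin r => V)
      (fun _ => V)).map_piecewise_smul (fun _ => t)
      (s.piecewise (fun _ => 1) fun _ : Fin r => h) s
    simp only [PiTensorProduct.mapMultilinear_apply, Finset.prod_const] at hs
    rw [← hs]
    congr 1
    ext i : 1
    by_cases hi : i ∈ s <;> simp [hi]
  have h0 := expand 0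
  rw [zero_smul, add_zero] at h0
  rw [h0]
  refine C.sum_pow_smul_mem_of_finite _ _ _ ?_ 0
  refine ((Module.End.finite_spectrum (-h))).subset fun t ht => ?_
  rw [Set.mem_ofPred_eq, ← expand] at ht
  contrapose! ht
  rw [spectrum.notMem_iff, sub_neg_eq_add, Algebra.algebraMap_eq_smul_one, add_comm] at ht
  obtain ⟨u, hu⟩ := ht
  rw [← hu]
  exact hC (LinearMap.GeneralLinearGroup.generalLinearEquiv ℂ V u)

/-- The operators `f_1 ⊗ ⋯ ⊗ f_r` span `End (V^{⊗ r})`. -/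
theorem PiTensorProduct.span_range_map_eq_top {k ι V : Type*} [Field k] [Finite ι]
    [AddCommGroup V] [Module k V] [FiniteDimensional k V] :
    Submodule.span k (Set.range fun f : ι → Module.End k V => PiTensorProduct.map f) = ⊤ := by
  cases nonempty_fintype ι
  classical
  let b := Module.finBasis k V
  let B := Basis.piTensorProduct fun _ : ι => b
  refine eq_top_iff.mpr fun T _ => ?_
  have hT : T = ∑ q, ∑ p, B.repr (T (B q)) p •
      PiTensorProduct.map fun i => (b.coord (q i)).smulRight (b (p i)) := by
    refine B.ext fun q => ?_
    have key (q' p : ι → Fin (finrank k V)) :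
        PiTensorProduct.map (fun i => (b.coord (q' i)).smulRight (b (p i))) (B q) =
          if q' = q then B p else 0 := by
      simp only [B, Basis.piTensorProduct_apply, PiTensorProduct.map_tprod,
        LinearMap.smulRight_apply, Basis.coord_apply, Basis.repr_self]
      rw [MultilinearMap.map_smul_univ]
      split_ifs with h
      · simp [h]
      · obtain ⟨i, hi⟩ := Function.ne_iff.mp h
        rw [Finset.prod_eq_zero (Finset.mem_univ i) (by simp [Ne.symm hi]), zero_smul]
    simp only [LinearMap.sum_apply, LinearMap.smul_apply, key]
    rw [Finset.sum_eq_single q (fun q' _ h => by simp [h]) (by simp)]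
    simp [B.sum_repr]
  rw [hT]
  exact Submodule.sum_mem _ fun q _ => Submodule.sum_mem _ fun p _ =>
    Submodule.smul_mem _ _ (Submodule.subset_span ⟨_, rfl⟩)

theorem permOp_tprod {V : Type*} [AddCommGroup V] [Module ℂ V] {r : ℕ}
    (σ : Equiv.Perm (Fin r)) (v : Fin r → V) :
    permOp V r σ (PiTensorProduct.tprod ℂ v) = PiTensorProduct.tprod ℂ fun i => v (σ.symm i) :=
  PiTensorProduct.reindex_tprod σ v

/-- The permutation action of the symmetric group on `V^{⊗ r}`. -/
noncomputable def permRep (V : Type*) [AddCommGroup V] [Module ℂ V] (r : ℕ) :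
    Representation ℂ (Equiv.Perm (Fin r)) (⨂[ℂ] _ : Fin r, V) where
  toFun := permOp V r
  map_one' := by
    ext v
    simp [permOp_tprod, Equiv.Perm.one_def]
  map_mul' σ τ := by
    ext v
    simp [permOp_tprod, Equiv.Perm.mul_def]

theorem permOp_comp_map {V : Type*} [AddCommGroup V] [Module ℂ V] {r : ℕ}
    (σ : Equiv.Perm (Fin r)) (f : Fin r → Module.End ℂ V) :
    permOp V r σ ∘ₗ PiTensorProduct.map f =
      (PiTensorProduct.map fun i => f (σ.symm i)) ∘ₗ permOp V r σ := by
  ext v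
  simp [permOp_tprod]

/-- A subspace containing all `g^{⊗ r}` with `g` invertible contains every operator commuting with
the permutation operators. -/
theorem mem_of_commute_permOp {V : Type*} [AddCommGroup V] [Module ℂ V]
    [FiniteDimensional ℂ V] {r : ℕ} (C : Submodule ℂ (Module.End ℂ (⨂[ℂ] _ : Fin r, V)))
    (hC : ∀ g : V ≃ₗ[ℂ] V, tensorPow V r g ∈ C) (T : Module.End ℂ (⨂[ℂ] _ : Fin r, V))
    (hT : ∀ σ, Commute T (permRep V r σ)) : T ∈ C := by
  let S : Module.End ℂ (Module.End ℂ (⨂[ℂ] _ : Fin r, V)) :=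
    ∑ σ : Equiv.Perm (Fin r),
      LinearMap.mulLeft ℂ (permRep V r σ) ∘ₗ LinearMap.mulRight ℂ (permRep V r σ⁻¹)
  have hS (U) : S U = ∑ σ : Equiv.Perm (Fin r), permRep V r σ * (U * permRep V r σ⁻¹) := by
    simp [S]
  have hSC : ⊤ ≤ C.comap S := by
    rw [← PiTensorProduct.span_range_map_eq_top, Submodule.span_le]
    rintro _ ⟨f, rfl⟩
    rw [SetLike.mem_coe, Submodule.mem_comap, hS]
    have conj (σ : Equiv.Perm (Fin r)) :
        permRep V r σ * (PiTensorProduct.map f * permRep V r σ⁻¹) =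
          PiTensorProduct.map fun i => f (σ.symm i) := by
      rw [← mul_assoc, show permRep V r σ * PiTensorProduct.map f = _ from permOp_comp_map σ f]
      change _ * permRep V r σ * _ = _
      rw [mul_assoc, ← map_mul, mul_inv_cancel, map_one, mul_one]
    simp_rw [conj]
    rw [← Equiv.sum_comp (Equiv.inv (Equiv.Perm (Fin r)))]
    have pol := MultilinearMap.sum_neg_one_pow_card_smul_map_const
      (PiTensorProduct.mapMultilinear ℂ (fun _ : Fin r => V) (fun _ => V)) f
    have hmem := C.smul_mem ((-1 : ℂ) ^ Fintype.card (Fin r)) <|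
      pol ▸ C.sum_mem (t := Finset.univ) fun s _ => C.smul_mem ((-1 : ℂ) ^ #s) <|
        map_const_mem_of_tensorPow_mem C hC (∑ i ∈ s, f i)
    rw [smul_smul, ← mul_pow, neg_one_mul, neg_neg, one_pow, one_smul] at hmem
    exact hmem
  have hST : S T = (Fintype.card (Equiv.Perm (Fin r)) : ℂ) • T := by
    rw [hS, Finset.sum_congr rfl fun σ _ => show _ = T by
      rw [← mul_assoc, ← (hT σ).eq, mul_assoc, ← map_mul, mul_inv_cancel, map_one, mul_one]]
    simp [Nat.cast_smul_eq_nsmul]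
  have hmem : S T ∈ C := hSC trivial
  rw [hST] at hmem
  exact (C.smul_mem_iff (by exact_mod_cast Fintype.card_ne_zero)).mp hmem

theorem linearIndependent_permOp {V : Type*} [AddCommGroup V] [Module ℂ V]
    [FiniteDimensional ℂ V] {r : ℕ} (h : r ≤ finrank ℂ V) :
    LinearIndependent ℂ fun σ : Equiv.Perm (Fin r) => permOp V r σ := by
  let b := Module.finBasis ℂ V
  let B := Basis.piTensorProduct fun _ : Fin r => b
  have hB := B.linearIndependent.comp
    (fun (σ : Equiv.Perm (Fin r)) i => Fin.castLE h (σ.symm i)) fun σ τ hστ =>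
      Equiv.symm_bijective.injective <| Equiv.ext fun i =>
        Fin.castLE_injective h (congrFun hστ i)
  let ev : Module.End ℂ (⨂[ℂ] _ : Fin r, V) →ₗ[ℂ] ⨂[ℂ] _ : Fin r, V :=
    LinearMap.applyₗ (PiTensorProduct.tprod ℂ fun i => b (Fin.castLE h i))
  have hev : (ev ∘ fun σ => permOp V r σ) =
      B ∘ fun (σ : Equiv.Perm (Fin r)) i => Fin.castLE h (σ.symm i) := by
    ext σ
    simp [ev, B, permOp_tprod]
  exact LinearIndependent.of_comp ev (hev ▸ hB)

/-- Schur–Weyl duality, first half: the image of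
`ρ : ℂ[𝔖_r] → End(V^{⊗r})` (i.e. the span of the permutation operators `P_σ`)
equals the commutant of the diagonal `GL(V)`-action on `V^{⊗r}`; and if
`dim V ≥ r` then `ρ` is injective (the `P_σ` are linearly independent), so
`ℂ[𝔖_r] ≅ End_{GL(V)}(V^{⊗r})`. -/
theorem schur_weyl_duality_first_half
    (V : Type*) [AddCommGroup V] [Module ℂ V] [FiniteDimensional ℂ V]
    (r : ℕ) (hr : 1 ≤ r) :
    ((Submodule.span ℂ
        {f : Module.End ℂ (⨂[ℂ] _ : Fin r, V) |
          ∃ σ : Equiv.Perm (Fin r), f = permOp V r σ} :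
        Set (Module.End ℂ (⨂[ℂ] _ : Fin r, V)))
      = {f : Module.End ℂ (⨂[ℂ] _ : Fin r, V) |
          ∀ g : V ≃ₗ[ℂ] V, f ∘ₗ tensorPow V r g = tensorPow V r g ∘ₗ f}) ∧
    (r ≤ finrank ℂ V →
      LinearIndependent ℂ fun σ : Equiv.Perm (Fin r) => permOp V r σ) := by
  refine ⟨Set.Subset.antisymm ?_ ?_, linearIndependent_permOp⟩
  · intro f hf g
    induction hf using Submodule.span_induction with
    | mem f hf =>
      obtain ⟨σ, rfl⟩ := hf
      exact permOp_comp_map σ fun _ => (g : V →ₗ[ℂ] V)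
    | zero => simp
    | add f₁ f₂ _ _ h₁ h₂ => rw [LinearMap.add_comp, LinearMap.comp_add, h₁, h₂]
    | smul c f _ h => rw [LinearMap.smul_comp, LinearMap.comp_smul, h]
  · intro f hf
    have hspan := (permRep V r).mem_span_range_of_commute f fun T hT =>
      (Subalgebra.mem_centralizer_iff ℂ).mp
        (mem_of_commute_permOp (Subalgebra.centralizer ℂ {f}).toSubmodule
          (fun g => (Subalgebra.mem_centralizer_iff ℂ).mpr fun f' hf' => by
            rw [Set.mem_singleton_iff.mp hf']
            exact hf g) T hT) f rfl
    refine Submodule.span_mono ?_ hspan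
    rintro _ ⟨σ, rfl⟩
    exact ⟨σ, rfl⟩
end

section
/- Let k be a field, n ≥ 1, d = (d_1,…,d_n) ∈ ℕ^n, r = Σ_i d_i, V_i = k^{d_i}, L = ⊕_{i=1}^n V_i and V^i = ⊕_{j ≤ i} V_j. For φ = (φ_1,…,φ_{n−1}) ∈ E(d) define, for 1 ≤ i ≤ n, U_i(φ) = { (x_1,…,x_n) ∈ L : x_{j+1} = φ_j(x_j) for all j ≥ i }. Then: (1) 0 = U_0(φ) ⊆ U_1(φ) ⊆ ⋯ ⊆ U_n(φ) = L is a flag with dim U_i(φ)/U_{i−1}(φ) = d_i and V^{i−1} ⊆ U_i(φ) for all i; (2) the map ι : φ ↦ (U_i(φ)) is injective; and (3) a flag (U_i) ∈ F_d with V^{i−1} ⊆ U_i for all i lies in the image of ι if and only if U_i ∩ (⊕_{j > i} V_j) = 0 for all i. (Zelevinsky's embedding of E(d) as an open subset of a Schubert variety in the partial flag variety F_d.) -/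
open Module LinearMap Finset

variable (k : Type*) [Field k] (d : ℕ → ℕ)

/-- The subspace `U_i(φ) = {x ∈ L : x_{j+1} = φ_j(x_j) for all j ≥ i}` of
`L = ⊕ⱼ k^{dⱼ}` attached by Zelevinsky to a representation `φ ∈ E(d)`. -/
def Usub (φ : ∀ j : ℕ, (Fin (d j) → k) →ₗ[k] (Fin (d (j + 1)) → k)) (i : ℕ) :
    Submodule k (∀ j : ℕ, Fin (d j) → k) where
  carrier := {x | ∀ j, i ≤ j → x (j + 1) = φ j (x j)}
  add_mem' := by
    intro a b ha hb j hj
    simp [ha j hj, hb j hj, map_add]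
  zero_mem' := by
    intro j hj
    simp
  smul_mem' := by
    intro c a ha j hj
    simp [ha j hj, map_smul]

/-- The graded subspace `V^i = ⊕_{j ≤ i} k^{dⱼ}` of `L`. -/
def Vle (i : ℕ) : Submodule k (∀ j : ℕ, Fin (d j) → k) where
  carrier := {x | ∀ j, i < j → x j = 0}
  add_mem' := by intro a b ha hb j hj; simp [ha j hj, hb j hj]
  zero_mem' := by intro j hj; simp
  smul_mem' := by intro c a ha j hj; simp [ha j hj]

/-- The graded subspace `⊕_{j > i} k^{dⱼ}` of `L`. -/
def Vgt (i : ℕ) : Submodule k (∀ j : ℕ, Fin (d j) → k) where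
  carrier := {x | ∀ j, j ≤ i → x j = 0}
  add_mem' := by intro a b ha hb j hj; simp [ha j hj, hb j hj]
  zero_mem' := by intro j hj; simp
  smul_mem' := by intro c a ha j hj; simp [ha j hj]

variable {k d}

/-- Every `v ∈ k^{d_i}` is the first nonzero component of an element of `U_i(φ)`. -/
theorem exists_mem_Usub (φ : ∀ j : ℕ, (Fin (d j) → k) →ₗ[k] (Fin (d (j + 1)) → k)) (i : ℕ)
    (v : Fin (d i) → k) :
    ∃ x ∈ Usub k d φ i, (∀ j < i, x j = 0) ∧ x i = v := by
  let s : ∀ j : ℕ, Fin (d j) → k := Pi.single i v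
  let x : ∀ j : ℕ, Fin (d j) → k := fun j =>
    Nat.rec (s 0) (fun j y => if i ≤ j then φ j y else s (j + 1)) j
  have hs : ∀ j ≤ i, x j = s j := by
    rintro (_ | j) hj
    · rfl
    · exact if_neg (by lia)
  refine ⟨x, fun j hj => if_pos hj, fun j hj => ?_, ?_⟩
  · rw [hs j hj.le]
    exact Pi.single_eq_of_ne (M := fun j => Fin (d j) → k) hj.ne v
  · rw [hs i le_rfl]
    exact Pi.single_eq_same (M := fun j => Fin (d j) → k) i v

theorem Usub_mono_succ (φ : ∀ j : ℕ, (Fin (d j) → k) →ₗ[k] (Fin (d (j + 1)) → k)) (i : ℕ) :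
    Usub k d φ i ≤ Usub k d φ (i + 1) :=
  fun _ hx j hj => hx j (by lia)

theorem eq_zero_of_mem_Usub (φ : ∀ j : ℕ, (Fin (d j) → k) →ₗ[k] (Fin (d (j + 1)) → k)) {i : ℕ}
    {x : ∀ j : ℕ, Fin (d j) → k} (hx : x ∈ Usub k d φ i) (h : ∀ j ≤ i, x j = 0) : x = 0 := by
  funext j
  induction j with
  | zero => exact h 0 (Nat.zero_le i)
  | succ j ih =>
    rcases lt_or_ge j i with hj | hj
    · exact h _ hj
    · rw [hx j hj, ih]
      exact map_zero _

theorem finiteDimensional_pi_of_eventually_zero {n : ℕ} (hdn : ∀ j, n < j → d j = 0) :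
    FiniteDimensional k (∀ j : ℕ, Fin (d j) → k) := by
  let f : (∀ j : ℕ, Fin (d j) → k) →ₗ[k] (∀ j : Fin (n + 1), Fin (d j) → k) :=
    LinearMap.pi fun j => LinearMap.proj (j : ℕ)
  refine Module.Finite.of_injective f fun x y h => ?_
  funext j
  rcases le_or_gt j n with hj | hj
  · exact congrFun h ⟨j, by lia⟩
  · have : IsEmpty (Fin (d j)) := by rw [hdn j hj]; infer_instance
    exact Subsingleton.elim _ _

theorem finrank_Usub_succ [FiniteDimensional k (∀ j : ℕ, Fin (d j) → k)]
    (φ : ∀ j : ℕ, (Fin (d j) → k) →ₗ[k] (Fin (d (j + 1)) → k)) (i : ℕ) :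
    finrank k (Usub k d φ (i + 1)) = finrank k (Usub k d φ i) + d (i + 1) := by
  let g : (∀ j : ℕ, Fin (d j) → k) →ₗ[k] (Fin (d (i + 1)) → k) :=
    LinearMap.proj (i + 1) - φ i ∘ₗ LinearMap.proj (φ := fun j => Fin (d j) → k) i
  let f := g.domRestrict (Usub k d φ (i + 1))
  have hf : Function.Surjective f := by
    intro v
    obtain ⟨x, hx, hx0, hxv⟩ := exists_mem_Usub φ (i + 1) v
    refine ⟨⟨x, hx⟩, ?_⟩
    simp [f, g, hx0 i (Nat.lt_succ_self i), hxv]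
  have hker : LinearMap.ker f = (Usub k d φ i).comap (Usub k d φ (i + 1)).subtype := by
    ext ⟨x, hx⟩
    have hfx : f ⟨x, hx⟩ = x (i + 1) - φ i (x i) := rfl
    rw [LinearMap.mem_ker, hfx, sub_eq_zero]
    refine ⟨fun h j hj => ?_, fun h => h i le_rfl⟩
    rcases hj.eq_or_lt with rfl | hj
    · exact h
    · exact hx j hj
  have h := f.finrank_range_add_finrank_ker
  rw [LinearMap.range_eq_top.2 hf, finrank_top, hker,
    (Submodule.comapSubtypeEquivOfLe (Usub_mono_succ φ i)).finrank_eq,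
    finrank_fin_fun] at h
  rw [← h, add_comm]

/-- If `V^{i-1} ⊆ W` and `W ∩ ⊕_{j>i} V_j = 0`, then on `W` the component `x_{i+1}` is a linear
function of `x_i`. -/
theorem exists_apply_succ_eq {W : Submodule k (∀ j : ℕ, Fin (d j) → k)} {i : ℕ}
    (hV : ∀ x : ∀ j : ℕ, Fin (d j) → k, (∀ j, i ≤ j → x j = 0) → x ∈ W)
    (hW : W ⊓ Vgt k d i = ⊥) :
    ∃ φ : (Fin (d i) → k) →ₗ[k] (Fin (d (i + 1)) → k), ∀ x ∈ W, x (i + 1) = φ (x i) := by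
  let p : W →ₗ[k] (Fin (d i) → k) := (LinearMap.proj i).domRestrict W
  let q : W →ₗ[k] (Fin (d (i + 1)) → k) := (LinearMap.proj (i + 1)).domRestrict W
  have hpq : LinearMap.ker p ≤ LinearMap.ker q := by
    rintro ⟨x, hx⟩ hxi
    replace hxi : x i = 0 := hxi
    let t : ∀ j : ℕ, Fin (d j) → k := fun j => if j < i then x j else 0
    have ht : t ∈ W := hV t fun j hj => if_neg (by lia)
    have hxt : x - t ∈ W ⊓ Vgt k d i := by
      refine ⟨W.sub_mem hx ht, fun j hj => ?_⟩
      rcases hj.eq_or_lt with rfl | hj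
      · simp [t, hxi]
      · simp [t, hj]
    rw [hW, Submodule.mem_bot] at hxt
    have := congrFun hxt (i + 1)
    simpa [t, q] using this
  obtain ⟨φ, hφ⟩ := LinearMap.exists_extend
    ((LinearMap.ker p).liftQ q hpq ∘ₗ p.quotKerEquivRange.symm.toLinearMap)
  refine ⟨φ, fun x hx => ?_⟩
  have h := LinearMap.congr_fun hφ ⟨p ⟨x, hx⟩, LinearMap.mem_range_self p _⟩
  have h' : p.quotKerEquivRange.symm ⟨p ⟨x, hx⟩, LinearMap.mem_range_self p _⟩ =
      (LinearMap.ker p).mkQ ⟨x, hx⟩ :=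
    p.quotKerEquivRange_symm_apply_image ⟨x, hx⟩ _
  rw [LinearMap.comp_apply, LinearMap.comp_apply, LinearEquiv.coe_coe, h'] at h
  exact h.symm

variable (k d)

/-- Zelevinsky's embedding of the representation space `E(d)` of the
equioriented quiver `Δ_n` into the partial flag variety `F_d` :
(1) `φ ↦ (U_i(φ))` lands in the Schubert variety of flags containing
`(V^{i-1})`; (2) it is injective; (3) its image consists exactly of the flags
`(U_i)` with `V^{i-1} ⊆ U_i` satisfying the open condition
`U_i ∩ (⊕_{j>i} V_j) = 0`. -/
theorem zelevinsky_embedding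
    (n : ℕ) (hn : 1 ≤ n) (hd0 : d 0 = 0) (hdn : ∀ j, n < j → d j = 0) :
    (∀ φ : ∀ j : ℕ, (Fin (d j) → k) →ₗ[k] (Fin (d (j + 1)) → k),
      Usub k d φ 0 = ⊥ ∧ (∀ i, Usub k d φ i ≤ Usub k d φ (i + 1)) ∧
      (∀ i, n ≤ i → Usub k d φ i = ⊤) ∧
      (∀ i, 1 ≤ i → i ≤ n →
        finrank k (Usub k d φ i) = finrank k (Usub k d φ (i - 1)) + d i) ∧
      (∀ i, 1 ≤ i → i ≤ n → Vle k d (i - 1) ≤ Usub k d φ i)) ∧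
    (∀ φ ψ : ∀ j : ℕ, (Fin (d j) → k) →ₗ[k] (Fin (d (j + 1)) → k),
      (∀ i, Usub k d φ i = Usub k d ψ i) → φ = ψ) ∧
    ∀ W : ℕ → Submodule k (∀ j : ℕ, Fin (d j) → k),
      W 0 = ⊥ → (∀ i, W i ≤ W (i + 1)) → (∀ i, n ≤ i → W i = ⊤) →
      (∀ i, 1 ≤ i → i ≤ n → finrank k (W i) = finrank k (W (i - 1)) + d i) →
      (∀ i, 1 ≤ i → i ≤ n → Vle k d (i - 1) ≤ W i) →
      ((∃ φ : ∀ j : ℕ, (Fin (d j) → k) →ₗ[k] (Fin (d (j + 1)) → k),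
          ∀ i, W i = Usub k d φ i) ↔
        ∀ i, W i ⊓ Vgt k d i = ⊥) := by
  have : FiniteDimensional k (∀ j : ℕ, Fin (d j) → k) :=
    finiteDimensional_pi_of_eventually_zero hdn
  have hempty : ∀ {j}, d j = 0 → Subsingleton (Fin (d j) → k) := by
    intro j hj
    rw [hj]
    infer_instance
  have hbot : ∀ φ, Usub k d φ 0 = ⊥ := by
    refine fun φ => (Submodule.eq_bot_iff _).2 fun x hx => eq_zero_of_mem_Usub φ hx fun j hj => ?_
    have := hempty (j := j) (by rwa [Nat.le_zero.1 hj])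
    exact Subsingleton.elim _ _
  have htop : ∀ φ i, n ≤ i → Usub k d φ i = ⊤ := by
    refine fun φ i hi => Submodule.eq_top_iff'.2 fun x j hj => ?_
    have := hempty (hdn (j + 1) (by lia))
    exact Subsingleton.elim _ _
  refine ⟨fun φ => ⟨hbot φ, Usub_mono_succ φ, htop φ, ?_, ?_⟩, ?_, ?_⟩
  · intro i hi _
    obtain ⟨m, rfl⟩ := Nat.exists_eq_add_of_le' hi
    exact finrank_Usub_succ φ m
  · intro i hi _ x hx j hj
    rw [hx j (by lia), hx (j + 1) (by lia)]
    exact (map_zero _).symm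
  · intro φ ψ h
    funext j
    refine LinearMap.ext fun v => ?_
    obtain ⟨x, hx, -, rfl⟩ := exists_mem_Usub φ j v
    have hx' : x ∈ Usub k d ψ j := h j ▸ hx
    rw [← hx j le_rfl, ← hx' j le_rfl]
  · intro W hW0 hWmono hWtop hWrank hWV
    constructor
    · rintro ⟨φ, hφ⟩ i
      rw [hφ i, Submodule.eq_bot_iff]
      exact fun x hx => eq_zero_of_mem_Usub φ hx.1 hx.2
    · intro hW
      have hstep : ∀ i, ∃ φ : (Fin (d i) → k) →ₗ[k] (Fin (d (i + 1)) → k),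
          ∀ x ∈ W i, x (i + 1) = φ (x i) := by
        refine fun i => exists_apply_succ_eq (fun x hx => ?_) (hW i)
        rcases Nat.eq_zero_or_pos i with rfl | hi
        · have : x = 0 := funext fun j => hx j (Nat.zero_le j)
          exact this ▸ Submodule.zero_mem _
        · rcases le_or_gt i n with hin | hin
          · exact hWV i hi hin fun j hj => hx j (by lia)
          · rw [hWtop i hin.le]
            exact Submodule.mem_top
      choose φ hφ using hstep
      refine ⟨φ, fun i => ?_⟩
      rcases le_or_gt i n with hin | hin
      · refine Submodule.eq_of_le_of_finrank_eq
          (fun x hx j hj => hφ j x (monotone_nat_of_le_succ hWmono hj hx)) ?_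
        induction i with
        | zero => rw [hW0, hbot]
        | succ i ih =>
          rw [hWrank (i + 1) (by lia) hin, finrank_Usub_succ, Nat.add_sub_cancel, ih (by lia)]
      · rw [hWtop i hin.le, htop φ i hin.le]
end
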